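/- arXiv:math/0104053 — 2 statements merged into one kernel-verified Lean document; each statement's English description precedes it below -/
import Mathlib

section
/- (Gordon's theorem) For all integers ν ≥ 1 and 0 ≤ s ≤ ν and every positive integer N, the number of partitions of N written in frequency form N = Σ_{j≥1} j·f_j (with all f_j ≥ 0, finitely many nonzero) satisfying f_1 ≤ s and f_j + f_{j+1} ≤ ν for all j ≥ 1 equals the number of partitions of N into parts not congruent to 0 or ±(s+1) modulo 2ν+3. -/
open PowerSeries

namespace GordonProof

noncomputable def cnt (P : Multiset ℕ → Prop) (N : ℕ) : ℕ :=
  Nat.card {p : Multiset ℕ // p.sum = N ∧ (∀ x ∈ p, 0 < x) ∧ P p}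

noncomputable def gf (P : Multiset ℕ → Prop) : ℤ⟦X⟧ := PowerSeries.mk fun N => (cnt P N : ℤ)

theorem fin_set (P : Multiset ℕ → Prop) (N : ℕ) :
    {p : Multiset ℕ | p.sum = N ∧ (∀ x ∈ p, 0 < x) ∧ P p}.Finite := by
  refine (Set.finite_range (fun p : N.Partition => p.parts)).subset ?_
  rintro p ⟨h1, h2, _⟩
  exact ⟨⟨p, fun {i} hi => h2 i hi, h1⟩, rfl⟩

theorem cnt_ncard (P : Multiset ℕ → Prop) (N : ℕ) :
    cnt P N = {p : Multiset ℕ | p.sum = N ∧ (∀ x ∈ p, 0 < x) ∧ P p}.ncard := rfl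

theorem gf_or (P Q : Multiset ℕ → Prop) (h : ∀ p, P p → Q p → False) :
    gf (fun p => P p ∨ Q p) = gf P + gf Q := by
  ext N
  simp only [gf, coeff_mk, map_add]
  rw [cnt_ncard, cnt_ncard, cnt_ncard, ← Nat.cast_add,
    ← Set.ncard_union_eq ?_ (fin_set _ _) (fin_set _ _)]
  · congr 2
    ext p
    simp only [Set.mem_ofPred_eq, Set.mem_union]
    tauto
  · rw [Set.disjoint_left]
    rintro p ⟨_, _, h1⟩ ⟨_, _, h2⟩
    exact h p h1 h2

theorem gf_congr {P Q : Multiset ℕ → Prop} (h : ∀ p, P p ↔ Q p) : gf P = gf Q := by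
  have : P = Q := by ext p; exact h p
  rw [this]

theorem gf_shift (P : Multiset ℕ → Prop) (a b : ℕ) (hb : 0 < b) :
    gf (fun p => ∃ p', p = p' + Multiset.replicate a b ∧ P p') = X ^ (a * b) * gf P := by
  ext N
  rw [coeff_X_pow_mul']
  simp only [gf, coeff_mk]
  split_ifs with h
  · rw [cnt_ncard, cnt_ncard]
    congr 1
    rw [← Set.ncard_image_of_injective
      {p : Multiset ℕ | p.sum = N - a * b ∧ (∀ x ∈ p, 0 < x) ∧ P p}
      (add_left_injective (Multiset.replicate a b))]
    congr 1
    ext p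
    simp only [Set.mem_ofPred_eq, Set.mem_image]
    constructor
    · rintro ⟨h1, h2, p', rfl, h3⟩
      refine ⟨p', ⟨?_, fun x hx => h2 x (by simp [hx]), h3⟩, rfl⟩
      simp at h1
      omega
    · rintro ⟨p', ⟨h1, h2, h3⟩, rfl⟩
      refine ⟨by simp; omega, ?_, p', rfl, h3⟩
      intro x hx
      rcases Multiset.mem_add.1 hx with hx | hx
      · exact h2 x hx
      · rw [Multiset.eq_of_mem_replicate hx]; exact hb
  · rw [cnt_ncard]
    have : {p : Multiset ℕ | p.sum = N ∧ (∀ x ∈ p, 0 < x) ∧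
        ∃ p', p = p' + Multiset.replicate a b ∧ P p'} = ∅ := by
      ext p
      simp only [Set.mem_ofPred_eq, Set.mem_empty_iff_false, iff_false]
      rintro ⟨h1, h2, p', rfl, h3⟩
      simp at h1
      omega
    rw [this]; simp

theorem gf_one (P : Multiset ℕ → Prop) (m : ℕ) (h0 : P 0) (h : ∀ p, P p → ∀ x ∈ p, m < x) :
    (X : ℤ⟦X⟧) ^ (m + 1) ∣ gf P - 1 := by
  rw [X_pow_dvd_iff]
  intro N hN
  simp only [gf, map_sub, coeff_mk, coeff_one, cnt_ncard]
  split_ifs with h1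
  · subst h1
    have : {p : Multiset ℕ | p.sum = 0 ∧ (∀ x ∈ p, 0 < x) ∧ P p} = {0} := by
      ext p
      simp only [Set.mem_ofPred_eq, Set.mem_singleton_iff]
      constructor
      · rintro ⟨h1, h2, h3⟩
        rw [Multiset.eq_zero_iff_forall_notMem]
        intro x hx
        have := Multiset.sum_eq_zero_iff.1 h1 x hx
        have := h2 x hx
        omega
      · rintro rfl
        simpa using h0
    rw [this]; simp
  · have : {p : Multiset ℕ | p.sum = N ∧ (∀ x ∈ p, 0 < x) ∧ P p} = ∅ := by
      ext p
      simp only [Set.mem_ofPred_eq, Set.mem_empty_iff_false, iff_false]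
      rintro ⟨h2, h3, h4⟩
      obtain ⟨x, hx⟩ : ∃ x, x ∈ p := by
        apply Multiset.exists_mem_of_ne_zero
        rintro rfl
        simp at h2; omega
      have := h p h4 x hx
      have := Multiset.le_sum_of_mem hx
      omega
    rw [this]; simp

theorem card_partition (P : Multiset ℕ → Prop) (N : ℕ) :
    Nat.card {p : N.Partition // P p.parts} = cnt P N := by
  refine Nat.card_congr ⟨fun p => ⟨p.1.parts, p.1.parts_sum, fun x hx => p.1.parts_pos hx, p.2⟩,
    fun p => ⟨⟨p.1, fun {i} hi => p.2.2.1 i hi, p.2.1⟩, p.2.2.2⟩, ?_, ?_⟩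
  · intro p; rfl
  · intro p; rfl

/-- Gordon condition. -/
def GP (k m i : ℕ) (p : Multiset ℕ) : Prop :=
  (∀ x ∈ p, m < x) ∧ p.count (m + 1) < i ∧ ∀ j, m < j → p.count j + p.count (j + 1) < k

theorem GP_zero (k m : ℕ) : gf (GP k m 0) = 0 := by
  ext N
  simp only [gf, coeff_mk, map_zero, cnt_ncard]
  have : {p : Multiset ℕ | p.sum = N ∧ (∀ x ∈ p, 0 < x) ∧ GP k m 0 p} = ∅ := by
    ext p; simp [GP]
  rw [this]; simp

theorem GP_rec (k m i : ℕ) (hi : i < k) :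
    gf (GP k m (i + 1)) = gf (GP k m i) + X ^ (i * (m + 1)) * gf (GP k (m + 1) (k - i)) := by
  rw [← gf_shift _ _ _ (Nat.succ_pos m), ← gf_or]
  · apply gf_congr
    intro p
    constructor
    · rintro ⟨h1, h2, h3⟩
      by_cases hc : p.count (m + 1) < i
      · exact Or.inl ⟨h1, hc, h3⟩
      · right
        have hc' : p.count (m + 1) = i := by omega
        refine ⟨p.filter (fun x => ¬ (m + 1 = x)), ?_, ?_, ?_, ?_⟩
        · have h := Multiset.filter_add_not (fun x => m + 1 = x) p
          rw [Multiset.filter_eq p (m + 1), hc'] at h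
          rw [add_comm]; exact h.symm
        · intro x hx
          rw [Multiset.mem_filter] at hx
          have := h1 x hx.1
          omega
        · rw [Multiset.count_filter_of_pos (by omega)]
          have := h3 (m + 1) (by omega)
          omega
        · intro j hj
          rw [Multiset.count_filter_of_pos (by omega), Multiset.count_filter_of_pos (by omega)]
          exact h3 j (by omega)
    · rintro (⟨h1, h2, h3⟩ | ⟨p', rfl, h1, h2, h3⟩)
      · exact ⟨h1, by omega, h3⟩
      · have h0 : p'.count (m + 1) = 0 := by
          rw [Multiset.count_eq_zero]
          intro h
          have := h1 _ h
          omega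
        refine ⟨?_, ?_, ?_⟩
        · intro x hx
          rcases Multiset.mem_add.1 hx with hx | hx
          · have := h1 x hx
            omega
          · rw [Multiset.eq_of_mem_replicate hx]; omega
        · simp [h0]
        · intro j hj
          simp only [Multiset.count_add, Multiset.count_replicate]
          by_cases hj' : j = m + 1
          · subst hj'
            rw [if_pos rfl, if_neg (by omega), h0]
            omega
          · rw [if_neg (by omega), if_neg (by omega)]
            have := h3 j (by omega)
            omega
  · rintro p ⟨_, h, _⟩ ⟨p', rfl, _⟩
    simp at h

theorem GP_one (k m i : ℕ) (hi : 0 < i) (hk : 0 < k) :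
    (X : ℤ⟦X⟧) ^ (m + 1) ∣ gf (GP k m i) - 1 := by
  apply gf_one
  · simp [GP, hi]; exact fun _ _ => hk
  · intro p hp; exact hp.1

/-- Restricted parts. -/
def HP (S : ℕ → Prop) (m : ℕ) (p : Multiset ℕ) : Prop := ∀ x ∈ p, m < x ∧ S x

theorem HP_pos (S : ℕ → Prop) (m : ℕ) (h : S (m + 1)) :
    gf (HP S m) * (1 - X ^ (m + 1)) = gf (HP S (m + 1)) := by
  have : gf (HP S m) = gf (HP S (m + 1)) + X ^ (1 * (m + 1)) * gf (HP S m) := by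
    rw [← gf_shift _ _ _ (Nat.succ_pos m), ← gf_or]
    · apply gf_congr
      intro p
      constructor
      · intro hp
        by_cases hc : m + 1 ∈ p
        · right
          obtain ⟨t, rfl⟩ := Multiset.exists_cons_of_mem hc
          refine ⟨t, by rw [Multiset.replicate_one, Multiset.add_comm, Multiset.singleton_add], ?_⟩
          intro x hx
          exact hp x (by simp [hx])
        · left
          intro x hx
          have := hp x hx
          refine ⟨?_, this.2⟩
          have : x ≠ m + 1 := by rintro rfl; exact hc hx
          omega
      · rintro (hp | ⟨p', rfl, hp⟩)
        · intro x hx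
          have := hp x hx
          exact ⟨by omega, this.2⟩
        · intro x hx
          rcases Multiset.mem_add.1 hx with hx | hx
          · exact hp x hx
          · rw [Multiset.eq_of_mem_replicate hx]; exact ⟨by omega, h⟩
    · rintro p h1 ⟨p', rfl, _⟩
      have := (h1 (m + 1) (by simp)).1
      omega
  rw [one_mul] at this
  linear_combination this

theorem HP_neg (S : ℕ → Prop) (m : ℕ) (h : ¬ S (m + 1)) :
    gf (HP S m) = gf (HP S (m + 1)) := by
  apply gf_congr
  intro p
  constructor
  · intro hp x hx
    have h1 := hp x hx
    refine ⟨?_, h1.2⟩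
    have : x ≠ m + 1 := by rintro rfl; exact h h1.2
    omega
  · intro hp x hx
    have h1 := hp x hx
    exact ⟨by omega, h1.2⟩

open Classical in
theorem HP_prod (S : ℕ → Prop) (m : ℕ) :
    gf (HP S 0) * ∏ j ∈ Finset.range m, (if S (j + 1) then 1 - X ^ (j + 1) else 1) =
      gf (HP S m) := by
  induction m with
  | zero => simp
  | succ m ih =>
    rw [Finset.prod_range_succ, ← mul_assoc, ih]
    split_ifs with h
    · exact HP_pos S m h
    · rw [mul_one, HP_neg S m h]

theorem HP_one (S : ℕ → Prop) (m : ℕ) : (X : ℤ⟦X⟧) ^ (m + 1) ∣ gf (HP S m) - 1 := by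
  apply gf_one
  · simp [HP]
  · intro p hp x hx; exact (hp x hx).1

/-- triangular numbers -/
def T (n : ℕ) : ℕ := ∑ j ∈ Finset.range (n + 1), j

theorem T_zero : T 0 = 0 := rfl
theorem T_succ (n : ℕ) : T (n + 1) = T n + (n + 1) := Finset.sum_range_succ _ _

noncomputable def Pm (m n : ℕ) : ℤ⟦X⟧ := ∏ j ∈ Finset.range m, (1 - X ^ (n + j + 1))

theorem Pm_last (m n : ℕ) : Pm (m + 1) n = Pm m n * (1 - X ^ (m + n + 1)) := by
  rw [Pm, Finset.prod_range_succ, ← Pm, add_comm n m]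

theorem Pm_first (m n : ℕ) : Pm (m + 1) n = Pm m (n + 1) * (1 - X ^ (n + 1)) := by
  rw [Pm, Finset.prod_range_succ', Pm]
  congr 1
  apply Finset.prod_congr rfl
  intro j _
  congr 2
  ring

/-- first and second exponents -/
def e1 (k m i n : ℕ) : ℕ := m * k * n + k * n ^ 2 + (k - i) * n + T n
def e2 (k m i n : ℕ) : ℕ := m * k * n + k * n ^ 2 + k * n + T n + (m + n + 1) * i

noncomputable def St (M k m i : ℕ) : ℤ⟦X⟧ :=
  ∑ n ∈ Finset.range M, (-1) ^ n * (X ^ e1 k m i n - X ^ e2 k m i n) * Pm m n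

theorem St_zero (M k m : ℕ) : St M k m 0 = 0 := by
  apply Finset.sum_eq_zero
  intro n _
  simp [e1, e2]

theorem St_rec (M k m i : ℕ) (hi : i < k) :
    St M k m (i + 1) - (St M k m i + X ^ (i * (m + 1)) * St M k (m + 1) (k - i)) =
    if M = 0 then 0 else
    (-1) ^ (M - 1) * X ^ e1 k m (i + 1) M * Pm (m + 1) (M - 1) := by
  induction M with
  | zero => simp [St]
  | succ M ih =>
    simp only [St, Finset.sum_range_succ] at ih ⊢
    rw [if_neg (by omega)]
    obtain ⟨c, rfl⟩ : ∃ c, k = i + 1 + c := ⟨k - (i + 1), by omega⟩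
    have hA : e1 (i + 1 + c) m (i + 1) (M + 1) =
        i * (m + 1) + e2 (i + 1 + c) (m + 1) (i + 1 + c - i) M := by
      simp only [e1, e2, T_succ]
      rw [show i + 1 + c - (i + 1) = c by omega, show i + 1 + c - i = c + 1 by omega]
      ring
    have hB : e2 (i + 1 + c) m i M =
        i * (m + 1) + e1 (i + 1 + c) (m + 1) (i + 1 + c - i) M := by
      simp only [e1, e2]
      rw [show i + 1 + c - (i + 1 + c - i) = i by omega]
      ring
    have hC : e1 (i + 1 + c) m i M = e1 (i + 1 + c) m (i + 1) M + M := by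
      simp only [e1]
      rw [show i + 1 + c - (i + 1) = c by omega, show i + 1 + c - i = c + 1 by omega]
      ring
    have hD : e2 (i + 1 + c) m (i + 1) M = e2 (i + 1 + c) m i M + (m + M + 1) := by
      simp only [e2]; ring
    have hA' := congrArg (fun e => (X : ℤ⟦X⟧) ^ e) hA
    have hB' := congrArg (fun e => (X : ℤ⟦X⟧) ^ e) hB
    have hC' := congrArg (fun e => (X : ℤ⟦X⟧) ^ e) hC
    have hD' := congrArg (fun e => (X : ℤ⟦X⟧) ^ e) hD
    simp only [pow_add _ (i * (m + 1))] at hA' hB'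
    rw [pow_add] at hC' hD'
    have hP := Pm_last m M
    rw [Nat.add_sub_cancel]
    rcases M with _ | M
    · simp only [if_true, Finset.range_zero, Finset.sum_empty] at ih ⊢
      linear_combination (-1 : ℤ⟦X⟧) ^ 0 * (Pm (m + 1) 0 * (-hA' + hB') - Pm m 0 * hC' - Pm m 0 * hD' - X ^ e2 (i + 1 + c) m i 0 * hP)
    · rw [if_neg (by omega), Nat.add_sub_cancel] at ih
      have hQ := Pm_first m M
      linear_combination ih + (-1 : ℤ⟦X⟧) ^ (M + 1) * (Pm (m + 1) (M + 1) * (-hA' + hB') - Pm m (M + 1) * hC' - Pm m (M + 1) * hD' - X ^ e2 (i + 1 + c) m i (M + 1) * hP)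
         + (-1) ^ M * X ^ e1 (i + 1 + c) m (i + 1) (M + 1) * hQ

theorem le_T (n : ℕ) : n ≤ T n := by
  cases n with
  | zero => simp
  | succ n => rw [T_succ]; omega

theorem St_rec_dvd (M k m i : ℕ) (hi : i < k) :
    X ^ M ∣ St M k m (i + 1) - (St M k m i + X ^ (i * (m + 1)) * St M k (m + 1) (k - i)) := by
  rw [St_rec M k m i hi]
  split_ifs
  · simp
  · apply Dvd.dvd.mul_right
    apply Dvd.dvd.mul_left
    apply pow_dvd_pow
    unfold e1
    have := le_T M
    omega

theorem St_one (M k m i : ℕ) (hM : M ≤ m) (hi : 0 < i) (hk : i ≤ k) :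
    X ^ M ∣ St M k m i - Pm m 0 := by
  rcases M with _ | M
  · simp
  rw [St, Finset.sum_range_succ']
  have : (-1) ^ 0 * ((X : ℤ⟦X⟧) ^ e1 k m i 0 - X ^ e2 k m i 0) * Pm m 0 - Pm m 0 = X ^ (M + 1) * (- X ^ (e2 k m i 0 - (M + 1)) * Pm m 0) := by
    have h : M + 1 ≤ e2 k m i 0 := by
      have : (m + 0 + 1) * 1 ≤ (m + 0 + 1) * i := Nat.mul_le_mul_left _ hi
      simp only [e2]
      omega
    have h2 : (X : ℤ⟦X⟧) ^ e2 k m i 0 = X ^ (M + 1) * X ^ (e2 k m i 0 - (M + 1)) := by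
      rw [← pow_add]; congr 1; omega
    rw [h2]
    simp [e1, T_zero]
    ring
  rw [add_sub_assoc, this]
  refine dvd_add (Finset.dvd_sum ?_) (dvd_mul_right _ _)
  intro n _
  have h0 : m ≤ m * k * (n + 1) := by
    have : m * 1 * 1 ≤ m * k * (n + 1) := by gcongr <;> omega
    omega
  apply Dvd.dvd.mul_right
  apply Dvd.dvd.mul_left
  apply dvd_sub
  · apply pow_dvd_pow
    unfold e1; omega
  · apply pow_dvd_pow
    unfold e2; omega


theorem main_congr (M k L : ℕ) (hL : M ≤ L) (hk : 0 < k) (t : ℕ) : ∀ m, m + t = L → ∀ i ≤ k,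
    X ^ M ∣ gf (GP k m i) * Pm L 0 - St M k m i := by
  induction t with
  | zero =>
    intro m hm i hi
    obtain rfl : m = L := by omega
    rcases Nat.eq_zero_or_pos i with rfl | h0
    · simp [GP_zero, St_zero]
    · have h1 := (pow_dvd_pow (X : ℤ⟦X⟧) (show M ≤ m + 1 by omega)).trans (GP_one k m i h0 hk)
      have h2 := St_one M k m i hL h0 hi
      have := (h1.mul_right (Pm m 0)).sub h2
      convert this using 1
      ring
  | succ t ih =>
    intro m hm i
    induction i with
    | zero => intro _; simp [GP_zero, St_zero]
    | succ i ihi =>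
      intro hi
      have h1 := ihi (by omega)
      have h2 := ih (m + 1) (by omega) (k - i) (by omega)
      have h3 := St_rec_dvd M k m i (by omega)
      rw [GP_rec k m i (by omega)]
      have := (h1.add (h2.mul_left (X ^ (i * (m + 1))))).sub h3
      convert this using 1
      ring

/-- Gaussian binomials. -/
noncomputable def bin (q : ℤ⟦X⟧) : ℕ → ℕ → ℤ⟦X⟧
  | _, 0 => 1
  | 0, _ + 1 => 0
  | n + 1, k + 1 => bin q n k + q ^ (k + 1) * bin q n (k + 1)

theorem bin_zero_right (q : ℤ⟦X⟧) (n : ℕ) : bin q n 0 = 1 := by cases n <;> rfl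

theorem bin_gt (q : ℤ⟦X⟧) (n : ℕ) : ∀ k, n < k → bin q n k = 0 := by
  induction n with
  | zero =>
    intro k hk
    obtain ⟨k, rfl⟩ : ∃ j, k = j + 1 := ⟨k - 1, by omega⟩
    rfl
  | succ n ih =>
    intro k hk
    obtain ⟨k, rfl⟩ : ∃ j, k = j + 1 := ⟨k - 1, by omega⟩
    rw [bin, ih k (by omega), ih (k + 1) (by omega)]; simp

theorem bin_self (q : ℤ⟦X⟧) (n : ℕ) : bin q n n = 1 := by
  induction n with
  | zero => rfl
  | succ n ih => rw [bin, ih, bin_gt q n (n + 1) (by omega)]; simp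

noncomputable def qp (q : ℤ⟦X⟧) (n : ℕ) : ℤ⟦X⟧ := ∏ j ∈ Finset.range n, (1 - q ^ (j + 1))

theorem qp_succ (q : ℤ⟦X⟧) (n : ℕ) : qp q (n + 1) = qp q n * (1 - q ^ (n + 1)) :=
  Finset.prod_range_succ _ _

theorem bin_qp (q : ℤ⟦X⟧) (a : ℕ) : ∀ b, bin q (a + b) a * qp q a * qp q b = qp q (a + b) := by
  induction a with
  | zero => intro b; simp [bin_zero_right, qp]
  | succ a iha =>
    intro b
    induction b with
    | zero => simp [bin_self, qp]
    | succ b ihb =>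
      have h1 := iha (b + 1)
      rw [show a + 1 + b = a + (b + 1) by ring] at ihb
      rw [show a + 1 + (b + 1) = (a + (b + 1)) + 1 by ring, bin, qp_succ q (a + (b + 1))]
      have e1 := qp_succ q a
      have e2 := qp_succ q b
      have : (q : ℤ⟦X⟧) ^ (a + (b + 1) + 1) = q ^ (a + 1) * q ^ (b + 1) := by
        rw [← pow_add]; congr 1; ring
      rw [this]
      linear_combination (1 - q ^ (a + 1)) * h1 + q ^ (a + 1) * (1 - q ^ (b + 1)) * ihb
        + bin q (a + (b + 1)) a * qp q (b + 1) * e1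
        + q ^ (a + 1) * bin q (a + (b + 1)) (a + 1) * qp q (a + 1) * e2

def Cc (n : ℕ) : ℕ := ∑ j ∈ Finset.range n, j

theorem Cc_succ (n : ℕ) : Cc (n + 1) = Cc n + n := Finset.sum_range_succ _ _
theorem Cc_zero : Cc 0 = 0 := rfl
theorem T_eq (n : ℕ) : T n = Cc n + n := Finset.sum_range_succ _ _

theorem Cc_add (a b : ℕ) : Cc (a + b) = Cc a + Cc b + a * b := by
  induction b with
  | zero => simp [Cc_zero]
  | succ b ih => rw [← add_assoc, Cc_succ, ih, Cc_succ]; ring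

theorem two_Cc (n : ℕ) : 2 * Cc n + n = n ^ 2 := by
  induction n with
  | zero => simp [Cc_zero]
  | succ n ih => rw [Cc_succ]; nlinarith

theorem q_binom (q y : ℤ⟦X⟧) (N : ℕ) : ∀ x, ∏ j ∈ Finset.range N, (y + x * q ^ j) =
    ∑ a ∈ Finset.range (N + 1), q ^ Cc a * bin q N a * x ^ a * y ^ (N - a) := by
  induction N with
  | zero => intro x; simp [Cc_zero, bin_zero_right]
  | succ N ih =>
    intro x
    rw [Finset.prod_range_succ']
    have h1 : ∏ j ∈ Finset.range N, (y + x * q ^ (j + 1)) =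
        ∏ j ∈ Finset.range N, (y + (x * q) * q ^ j) := by
      apply Finset.prod_congr rfl; intro j _; ring
    rw [h1, ih, pow_zero, mul_one, mul_add]
    have h2 : (∑ a ∈ Finset.range (N + 1), q ^ Cc a * bin q N a * (x * q) ^ a * y ^ (N - a)) * y =
        ∑ a ∈ Finset.range (N + 1 + 1), q ^ Cc a * bin q N a * (x * q) ^ a * y ^ (N + 1 - a) := by
      rw [Finset.sum_range_succ _ (N + 1), bin_gt q N (N + 1) (by omega), Finset.sum_mul]
      simp only [mul_zero, zero_mul, add_zero]
      apply Finset.sum_congr rfl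
      intro a ha
      rw [Finset.mem_range] at ha
      rw [show N + 1 - a = (N - a) + 1 by omega]; ring
    rw [h2, Finset.sum_range_succ', Finset.sum_range_succ' _ (N + 1), Finset.sum_mul,
      add_right_comm, ← Finset.sum_add_distrib]
    congr 1
    · apply Finset.sum_congr rfl
      intro a _
      rw [bin, Cc_succ, show N + 1 - (a + 1) = N - a by omega]
      ring
    · simp [bin_zero_right]

theorem qp_dvd (K r n : ℕ) (hK : 0 < K) (h : r ≤ n) :
    X ^ r ∣ qp ((X : ℤ⟦X⟧) ^ K) n - qp (X ^ K) r := by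
  induction n, h using Nat.le_induction with
  | base => simp
  | succ n hn ih =>
    rw [qp_succ]
    have h1 : (X : ℤ⟦X⟧) ^ r ∣ (X ^ K) ^ (n + 1) := by
      rw [← pow_mul]
      apply pow_dvd_pow
      have : 1 * (n + 1) ≤ K * (n + 1) := Nat.mul_le_mul_right _ hK
      omega
    have := ih.sub (h1.mul_left (qp (X ^ K) n))
    convert this using 1
    ring

theorem qp_unit (K r : ℕ) (hK : 0 < K) : IsUnit (qp ((X : ℤ⟦X⟧) ^ K) r) := by
  rw [PowerSeries.isUnit_iff_constantCoeff, qp, map_prod]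
  simp [hK.ne']

theorem bin_dvd (K r a b c : ℕ) (hK : 0 < K) (ha : r ≤ a) (hb : r ≤ b) (hc : r ≤ c) :
    X ^ r ∣ bin ((X : ℤ⟦X⟧) ^ K) (a + b) a * qp (X ^ K) c - 1 := by
  obtain ⟨wa, ha⟩ := qp_dvd K r a hK ha
  obtain ⟨wb, hb'⟩ := qp_dvd K r b hK hb
  obtain ⟨wc, hc⟩ := qp_dvd K r c hK hc
  obtain ⟨wd, hd⟩ := qp_dvd K r (a + b) hK (by omega)
  have h := bin_qp ((X : ℤ⟦X⟧) ^ K) a b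
  set u := qp ((X : ℤ⟦X⟧) ^ K) r
  set β := bin ((X : ℤ⟦X⟧) ^ K) (a + b) a
  have h1 : X ^ r ∣ u * (β * u - 1) := by
    refine ⟨wd - β * wa * qp (X ^ K) b - β * u * wb, ?_⟩
    linear_combination h + hd - β * qp (X ^ K) b * ha - β * u * hb'
  rw [(qp_unit K r hK).dvd_mul_left] at h1
  have := h1.add (Dvd.intro (β * wc) rfl : (X : ℤ⟦X⟧) ^ r ∣ X ^ r * (β * wc))
  convert this using 1
  linear_combination β * hc

/-- finite theta product -/
noncomputable def Fp (K i n : ℕ) : ℤ⟦X⟧ :=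
  ∏ j ∈ Finset.range n, ((1 - X ^ (K * j + i)) * (1 - X ^ (K * j + (K - i))))

theorem prod_aux (K i : ℕ) (hi : i ≤ K) (n : ℕ) :
    ∏ j ∈ Finset.range n, ((X : ℤ⟦X⟧) ^ (K * n) + (-X ^ i) * (X ^ K) ^ j) =
    (-1) ^ n * X ^ (i * n + K * Cc n) * ∏ j ∈ Finset.range n, (1 - X ^ (K * j + (K - i))) := by
  induction n with
  | zero => simp [Cc_zero]
  | succ n ih =>
    rw [Finset.prod_range_succ', Finset.prod_range_succ]
    have h1 : ∏ j ∈ Finset.range n, ((X : ℤ⟦X⟧) ^ (K * (n + 1)) + (-X ^ i) * (X ^ K) ^ (j + 1)) =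
        (X ^ K) ^ n * ∏ j ∈ Finset.range n, ((X : ℤ⟦X⟧) ^ (K * n) + (-X ^ i) * (X ^ K) ^ j) := by
      rw [← Finset.card_range n, ← Finset.prod_const, Finset.card_range, ← Finset.prod_mul_distrib]
      apply Finset.prod_congr rfl
      intro j _
      ring
    rw [h1, ih, Cc_succ]
    have h2 : (X : ℤ⟦X⟧) ^ (K * (n + 1)) = X ^ i * X ^ (K * n + (K - i)) := by
      rw [← pow_add]; congr 1; rw [mul_add]; omega
    rw [h2]
    ring

theorem prod_full (K i : ℕ) (hi : i ≤ K) (n : ℕ) :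
    ∏ j ∈ Finset.range (n + n), ((X : ℤ⟦X⟧) ^ (K * n) + (-X ^ i) * (X ^ K) ^ j) =
    (-1) ^ n * X ^ (i * n + K * Cc n + K * n * n) * Fp K i n := by
  rw [Finset.prod_range_add, prod_aux K i hi, Fp, Finset.prod_mul_distrib]
  have h1 : ∏ j ∈ Finset.range n, ((X : ℤ⟦X⟧) ^ (K * n) + (-X ^ i) * (X ^ K) ^ (n + j)) =
      (X ^ (K * n)) ^ n * ∏ j ∈ Finset.range n, (1 - X ^ (K * j + i)) := by
    rw [← Finset.card_range n, ← Finset.prod_const, Finset.card_range, ← Finset.prod_mul_distrib]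
    apply Finset.prod_congr rfl
    intro j _
    ring
  rw [h1]
  ring

theorem finite_jtp (k i : ℕ) (hi : i ≤ k) (n : ℕ) :
    Fp (2 * k + 1) i n =
      ∑ a ∈ Finset.range (n + 1), (-1) ^ a * X ^ e1 k 0 i a *
        bin ((X : ℤ⟦X⟧) ^ (2 * k + 1)) (n + n) (n - a) -
      ∑ a ∈ Finset.range n, (-1) ^ a * X ^ e2 k 0 i a *
        bin ((X : ℤ⟦X⟧) ^ (2 * k + 1)) (n + n) (n + 1 + a) := by
  have h := prod_full (2 * k + 1) i (by omega) n
  rw [q_binom, show n + n + 1 = (n + 1) + n by ring, Finset.sum_range_add,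
    ← Finset.sum_range_reflect] at h
  have hne : (-1 : ℤ⟦X⟧) ^ n * X ^ (i * n + (2 * k + 1) * Cc n + (2 * k + 1) * n * n) ≠ 0 := by
    apply mul_ne_zero
    · apply pow_ne_zero; simp
    · apply pow_ne_zero; exact X_ne_zero
  apply mul_left_cancel₀ hne
  rw [← h, mul_sub, sub_eq_add_neg, ← neg_mul, mul_comm (-_), Finset.mul_sum, Finset.sum_mul]
  congr 1
  · apply Finset.sum_congr rfl
    intro a ha
    rw [Finset.mem_range] at ha
    obtain ⟨r, rfl⟩ : ∃ r, n = a + r := ⟨n - a, by omega⟩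
    obtain ⟨c, rfl⟩ : ∃ c, k = i + c := ⟨k - i, by omega⟩
    rw [show a + r + 1 - 1 - a = r by omega, show a + r - a = r by omega,
      show a + r + (a + r) - r = a + (a + r) by omega]
    have hs : (-1 : ℤ⟦X⟧) ^ (a + r) * (-1) ^ a = (-1) ^ r := by
      rw [← pow_add, show a + r + a = 2 * a + r by ring, pow_add, pow_mul]; simp
    rw [neg_pow, ← hs]
    have he : (2 * (i + c) + 1) * Cc r + i * r + (2 * (i + c) + 1) * (a + r) * (a + (a + r)) =
       (i * (a + r) + (2 * (i + c) + 1) * Cc (a + r) + (2 * (i + c) + 1) * (a + r) * (a + r))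
        + e1 (i + c) 0 i a := by
      simp only [e1, T_eq, Cc_add]
      rw [show i + c - i = c by omega]
      linear_combination (i + c + 1) * (two_Cc a).symm
    have he' := congrArg (fun e => (X : ℤ⟦X⟧) ^ e) he
    simp only [pow_add _ (i * (a + r) + _ + _)] at he'
    rw [← pow_mul, ← pow_mul, ← pow_mul]
    rw [pow_add, pow_add] at he'
    linear_combination (-1) ^ (a + r) * (-1) ^ a *
      bin ((X : ℤ⟦X⟧) ^ (2 * (i + c) + 1)) (a + r + (a + r)) r * he'
  · apply Finset.sum_congr rfl
    intro a ha
    rw [Finset.mem_range] at ha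
    obtain ⟨r, rfl⟩ : ∃ r, n = a + 1 + r := ⟨n - (a + 1), by omega⟩
    rw [show a + 1 + r + (a + 1 + r) - (a + 1 + r + 1 + a) = r by omega]
    have hs : (-1 : ℤ⟦X⟧) ^ (a + 1 + r + 1 + a) = - ((-1) ^ (a + 1 + r) * (-1) ^ a) := by
      ring
    rw [neg_pow, hs]
    have he : (2 * k + 1) * Cc (a + 1 + r + 1 + a) + i * (a + 1 + r + 1 + a)
        + (2 * k + 1) * (a + 1 + r) * r =
       (i * (a + 1 + r) + (2 * k + 1) * Cc (a + 1 + r) + (2 * k + 1) * (a + 1 + r) * (a + 1 + r))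
        + e2 k 0 i a := by
      rw [show a + 1 + r + 1 + a = (a + 1 + r) + (a + 1) by ring, Cc_add (a + 1 + r) (a + 1)]
      simp only [e2, T_eq, Cc_succ]
      linear_combination k * (two_Cc a)
    have he' := congrArg (fun e => (X : ℤ⟦X⟧) ^ e) he
    simp only [pow_add _ (i * (a + 1 + r) + _ + _)] at he'
    rw [← pow_mul, ← pow_mul, ← pow_mul]
    rw [pow_add, pow_add] at he'
    linear_combination - (-1) ^ (a + 1 + r) * (-1) ^ a *
      bin ((X : ℤ⟦X⟧) ^ (2 * k + 1)) (a + 1 + r + (a + 1 + r)) (a + 1 + r + 1 + a) * he'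


theorem jtp_dvd (M k i : ℕ) (hi0 : 0 < i) (hi : i ≤ k) :
    X ^ M ∣ Fp (2 * k + 1) i M * qp ((X : ℤ⟦X⟧) ^ (2 * k + 1)) M - St M k 0 i := by
  rw [finite_jtp k i hi, St]
  simp only [Pm, Finset.range_zero, Finset.prod_empty, mul_one, mul_sub, Finset.sum_sub_distrib]
  rw [sub_mul, sub_sub_sub_comm, Finset.sum_range_succ, add_mul, add_sub_right_comm,
    Finset.sum_mul, Finset.sum_mul, ← Finset.sum_sub_distrib, ← Finset.sum_sub_distrib]
  refine dvd_sub (dvd_add (Finset.dvd_sum ?_) ?_) (Finset.dvd_sum ?_)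
  · intro a ha
    rw [Finset.mem_range] at ha
    have h := bin_dvd (2 * k + 1) (M - a) (M - a) (M + a) M (by omega) (by omega) (by omega)
      (by omega)
    rw [show M - a + (M + a) = M + M by omega] at h
    have h2 : (X : ℤ⟦X⟧) ^ a ∣ (-1) ^ a * X ^ e1 k 0 i a := by
      apply Dvd.dvd.mul_left
      apply pow_dvd_pow
      have := le_T a
      unfold e1; omega
    have := mul_dvd_mul h2 h
    rw [← pow_add, show a + (M - a) = M by omega] at this
    convert this using 1
    ring
  · apply Dvd.dvd.mul_right
    apply Dvd.dvd.mul_right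
    apply Dvd.dvd.mul_left
    apply pow_dvd_pow
    have := le_T M
    unfold e1; omega
  · intro a ha
    rw [Finset.mem_range] at ha
    have h := bin_dvd (2 * k + 1) (M - (a + 1)) (M + 1 + a) (M - (a + 1)) M (by omega) (by omega)
      (by omega) (by omega)
    rw [show M + 1 + a + (M - (a + 1)) = M + M by omega] at h
    have h2 : (X : ℤ⟦X⟧) ^ (a + 1) ∣ (-1) ^ a * X ^ e2 k 0 i a := by
      apply Dvd.dvd.mul_left
      apply pow_dvd_pow
      have : (0 + a + 1) * 1 ≤ (0 + a + 1) * i := Nat.mul_le_mul_left _ hi0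
      unfold e2; omega
    have := mul_dvd_mul h2 h
    rw [← pow_add, show a + 1 + (M - (a + 1)) = M by omega] at this
    convert this using 1
    ring

theorem bad_iff (k i n x : ℕ) (hi : 0 < i) (hik : i ≤ k) (hx : x < 2 * k + 1) :
    (¬ (((((2 * k + 1) * n + x + 1 : ℕ)) : ZMod (2 * k + 1)) ≠ 0 ∧
      (((2 * k + 1) * n + x + 1 : ℕ) : ZMod (2 * k + 1)) ≠ ((i : ℕ) : ZMod (2 * k + 1)) ∧
      (((2 * k + 1) * n + x + 1 : ℕ) : ZMod (2 * k + 1)) ≠ -((i : ℕ) : ZMod (2 * k + 1)))) ↔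
    (x = 2 * k ∨ x = i - 1 ∨ x = 2 * k - i) := by
  have h0 : (((2 * k + 1) * n + x + 1 : ℕ) : ZMod (2 * k + 1)) =
      ((x + 1 : ℕ) : ZMod (2 * k + 1)) := by
    rw [ZMod.natCast_eq_natCast_iff', add_assoc, Nat.mul_add_mod]
  rw [h0, ne_eq, ne_eq, ne_eq, eq_neg_iff_add_eq_zero, ← Nat.cast_add,
    ZMod.natCast_eq_zero_iff, ZMod.natCast_eq_zero_iff, ZMod.natCast_eq_natCast_iff',
    Nat.mod_eq_of_lt (show i < 2 * k + 1 by omega)]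
  have h1 : 2 * k + 1 ∣ x + 1 ↔ x = 2 * k := by
    constructor
    · intro h
      have := Nat.le_of_dvd (by omega) h
      omega
    · rintro rfl; rfl
  have h2 : 2 * k + 1 ∣ x + 1 + i ↔ x = 2 * k - i := by
    constructor
    · rintro ⟨t, ht⟩
      have : t = 1 := by
        rcases t with _ | _ | t
        · omega
        · rfl
        · exfalso
          have : (2 * k + 1) * (t + 1 + 1) = (2 * k + 1) * t + 2 * (2 * k + 1) := by ring
          omega
      subst this
      omega
    · rintro rfl
      refine ⟨1, by omega⟩
  have h3 : (x + 1) % (2 * k + 1) = i ↔ x = i - 1 := by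
    rcases Nat.lt_or_ge (x + 1) (2 * k + 1) with h | h
    · rw [Nat.mod_eq_of_lt h]; omega
    · obtain rfl : x = 2 * k := by omega
      rw [Nat.mod_self]; omega
  rw [h1, h2, h3]
  tauto

theorem Fp_succ (K i n : ℕ) : Fp K i (n + 1) =
    Fp K i n * ((1 - X ^ (K * n + i)) * (1 - X ^ (K * n + (K - i)))) :=
  Finset.prod_range_succ _ _

open Classical in
theorem bad_prod (k i : ℕ) (hi : 0 < i) (hik : i ≤ k) (S : ℕ → Prop)
    (hS : ∀ n x, x < 2 * k + 1 →
      (¬ S ((2 * k + 1) * n + x + 1) ↔ (x = 2 * k ∨ x = i - 1 ∨ x = 2 * k - i))) (n : ℕ) :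
    ∏ j ∈ Finset.range ((2 * k + 1) * n), (if S (j + 1) then (1 : ℤ⟦X⟧) else 1 - X ^ (j + 1)) =
      Fp (2 * k + 1) i n * qp (X ^ (2 * k + 1)) n := by
  induction n with
  | zero => simp [Fp, qp]
  | succ n ih =>
    rw [Nat.mul_succ, Finset.prod_range_add, ih, Fp_succ, qp_succ]
    have h : ∏ x ∈ Finset.range (2 * k + 1), (if S ((2 * k + 1) * n + x + 1) then (1 : ℤ⟦X⟧) else
        1 - X ^ ((2 * k + 1) * n + x + 1)) =
        ∏ x ∈ ({2 * k, i - 1, 2 * k - i} : Finset ℕ), (1 - X ^ ((2 * k + 1) * n + x + 1)) := by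
      rw [← Finset.prod_subset (s₁ := ({2 * k, i - 1, 2 * k - i} : Finset ℕ))]
      · apply Finset.prod_congr rfl
        intro x hx
        simp only [Finset.mem_insert, Finset.mem_singleton] at hx
        rw [if_neg ((hS n x (by omega)).2 hx)]
      · intro x hx
        simp only [Finset.mem_insert, Finset.mem_singleton] at hx
        rw [Finset.mem_range]; omega
      · intro x hx hx'
        simp only [Finset.mem_insert, Finset.mem_singleton] at hx'
        rw [Finset.mem_range] at hx
        rw [if_pos]
        by_contra hc
        exact hx' ((hS n x hx).1 hc)
    rw [h, Finset.prod_insert, Finset.prod_insert, Finset.prod_singleton]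
    · rw [show (2 * k + 1) * n + (i - 1) + 1 = (2 * k + 1) * n + i by omega,
        show (2 * k + 1) * n + (2 * k - i) + 1 = (2 * k + 1) * n + (2 * k + 1 - i) by omega]
      ring
    · simp; omega
    · simp; omega

theorem final (k i N : ℕ) (hi : 0 < i) (hik : i ≤ k) (S : ℕ → Prop)
    (hS : ∀ n x, x < 2 * k + 1 →
      (¬ S ((2 * k + 1) * n + x + 1) ↔ (x = 2 * k ∨ x = i - 1 ∨ x = 2 * k - i))) :
    cnt (GP k 0 i) N = cnt (HP S 0) N := by
  classical
  set M := N + 1 with hM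
  set L := (2 * k + 1) * M with hL
  have hML : M ≤ L := by
    have : 1 * M ≤ (2 * k + 1) * M := Nat.mul_le_mul_right _ (by omega)
    omega
  have h1 := main_congr M k L hML (by omega) L 0 (by omega) i hik
  have h2 := jtp_dvd M k i hi hik
  have h3 := (pow_dvd_pow (X : ℤ⟦X⟧) (show M ≤ L + 1 by omega)).trans (HP_one S L)
  rw [← HP_prod] at h3
  rw [← bad_prod k i hi hik S hS M, ← hL] at h2
  set A := ∏ j ∈ Finset.range L, (if S (j + 1) then (1 : ℤ⟦X⟧) - X ^ (j + 1) else 1) with hA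
  set B := ∏ j ∈ Finset.range L, (if S (j + 1) then (1 : ℤ⟦X⟧) else 1 - X ^ (j + 1)) with hB
  have hE : Pm L 0 = A * B := by
    rw [hA, hB, ← Finset.prod_mul_distrib, Pm]
    apply Finset.prod_congr rfl
    intro j _
    rw [zero_add]
    split_ifs <;> simp
  have h4 : X ^ M ∣ Pm L 0 * (gf (GP k 0 i) - gf (HP S 0)) := by
    have := (h1.sub h2).sub (h3.mul_right B)
    convert this using 1
    rw [hE]; ring
  have hu : IsUnit (Pm L 0) := by
    rw [PowerSeries.isUnit_iff_constantCoeff, Pm, map_prod]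
    simp
  rw [hu.dvd_mul_left, X_pow_dvd_iff] at h4
  have := h4 N (by omega)
  simp only [gf, map_sub, coeff_mk] at this
  omega

end GordonProof

/--
**Gordon's theorem.**
For all `ν ≥ 1`, `0 ≤ s ≤ ν`, and every positive integer `N`, the partitions of `N`
written in frequency form `N = Σ_{j≥1} j·f_j` (where `f_j = p.parts.count j` is the number
of parts equal to `j`) satisfying `f_1 ≤ s` and `f_j + f_{j+1} ≤ ν` for all `j ≥ 1`
are equinumerous with the partitions of `N` into parts not congruent to
`0` or `±(s+1)` modulo `2ν+3`.
-/
theorem gordon (ν s : ℕ) (hν : 1 ≤ ν) (hs : s ≤ ν) (N : ℕ) (hN : 0 < N) :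
    Nat.card {p : N.Partition //
        p.parts.count 1 ≤ s ∧ ∀ j : ℕ, 1 ≤ j → p.parts.count j + p.parts.count (j + 1) ≤ ν} =
    Nat.card {p : N.Partition // ∀ j ∈ p.parts,
        (j : ZMod (2 * ν + 3)) ≠ 0 ∧
        (j : ZMod (2 * ν + 3)) ≠ ((s + 1 : ℕ) : ZMod (2 * ν + 3)) ∧
        (j : ZMod (2 * ν + 3)) ≠ -((s + 1 : ℕ) : ZMod (2 * ν + 3))} := by
  set S : ℕ → Prop := fun j => (j : ZMod (2 * ν + 3)) ≠ 0 ∧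
        (j : ZMod (2 * ν + 3)) ≠ ((s + 1 : ℕ) : ZMod (2 * ν + 3)) ∧
        (j : ZMod (2 * ν + 3)) ≠ -((s + 1 : ℕ) : ZMod (2 * ν + 3)) with hSdef
  have h := GordonProof.final (ν + 1) (s + 1) N (by omega) (by omega) S
    (fun n x hx => GordonProof.bad_iff (ν + 1) (s + 1) n x (by omega) (by omega) hx)
  rw [← GordonProof.card_partition, ← GordonProof.card_partition] at h
  refine Eq.trans (Nat.card_congr (Equiv.subtypeEquivRight ?_))
    (h.trans (Nat.card_congr (Equiv.subtypeEquivRight ?_)))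
  · intro p
    simp only [GordonProof.GP, zero_add, Nat.lt_succ_iff]
    exact ⟨fun h => ⟨fun x hx => p.parts_pos hx, h.1, fun j hj => h.2 j hj⟩,
      fun h => ⟨h.2.1, fun j hj => h.2.2 j hj⟩⟩
  · intro p
    exact ⟨fun h j hj => (h j hj).2, fun h j hj => ⟨p.parts_pos hj, h j hj⟩⟩
end

section
/- (Andrews' theorem, the Andrews–Gordon identities) For all integers ν ≥ 1, 0 ≤ s ≤ ν, and all complex q with |q| < 1: Σ over tuples n = (n_1,…,n_ν) of nonnegative integers of q^{N_1²+⋯+N_ν²+N_{s+1}+⋯+N_ν} / ((q)_{n_1}(q)_{n_2}⋯(q)_{n_ν}) = ∏ over integers j ≥ 1 with j ≢ 0, ±(s+1) (mod 2ν+3) of 1/(1−q^j). -/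
open scoped Classical

noncomputable section

/-- The q-Pochhammer symbol `(q)_n = ∏_{j=1}^n (1 - q^j)`. -/
def qP {F : Type*} [Field F] (q : F) (n : ℕ) : F :=
  ∏ j ∈ Finset.range n, (1 - q ^ (j + 1))

/-- The q-binomial coefficient `[N choose k]_q = (q)_N / ((q)_k (q)_{N-k})`
for `0 ≤ k ≤ N`, and `0` otherwise. -/
def qB {F : Type*} [Field F] (q : F) (N k : ℤ) : F :=
  if 0 ≤ k ∧ k ≤ N then qP q N.toNat / (qP q k.toNat * qP q (N - k).toNat) else 0

/-- `NN n i = N_i = n_i + n_{i+1} + ⋯ + n_ν` (indices 1-based; `n ⟨k⟩` is `n_{k+1}`). -/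
def NN {ν : ℕ} (n : Fin ν → ℕ) (i : ℕ) : ℕ :=
  ∑ k : Fin ν, if i ≤ (k : ℕ) + 1 then n k else 0

/-- `α_{i,s} = max(0, i - s)`. -/
def alph (i s : ℕ) : ℤ := max 0 ((i : ℤ) - s)

/-- The exponent `N_1² + ⋯ + N_ν² + N_{s+1} + ⋯ + N_ν`. -/
def expAG (ν s : ℕ) (nn : Fin ν → ℕ) : ℕ :=
  (∑ i ∈ Finset.Icc 1 ν, (NN nn i) ^ 2) + ∑ i ∈ Finset.Icc (s + 1) ν, NN nn i

/-- The polynomial `B^ν_{s,b}(L,q)` of Foda–Quano–Kirillov type. -/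
def B {F : Type*} [Field F] (ν : ℕ) (s b : ℤ) (L : ℕ) (q : F) : F :=
  ∑ᶠ j : ℤ,
    (q ^ (j * ((2 * j + 1) * (2 * (ν : ℤ) + 3) - 2 * s)) *
        qB q (L : ℤ) (((L : ℤ) + b - s) / 2 + j * (2 * (ν : ℤ) + 3)) -
      q ^ ((2 * j + 1) * ((2 * (ν : ℤ) + 3) * j + s)) *
        qB q (L : ℤ) (((L : ℤ) + b + s) / 2 + j * (2 * (ν : ℤ) + 3)))

/-- `jjf j l = j_l` for `1 ≤ l ≤ ν` (and junk value `0` otherwise). -/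
def jjf {ν : ℕ} (j : Fin ν → ℕ) (l : ℕ) : ℤ :=
  if h : l - 1 < ν then (j ⟨l - 1, h⟩ : ℤ) else 0

/-- The q-multinomial coefficient `[L choose a]^(p)_ν`. -/
def qMulti {F : Type*} [Field F] (ν L : ℕ) (a : ℤ) (p : ℕ) (q : F) : F :=
  ∑ᶠ j : Fin ν → ℕ,
    if (∑ l, (j l : ℤ)) = a then
      q ^ ((∑ l ∈ Finset.Icc 2 ν, jjf j (l - 1) * ((L : ℤ) - jjf j l)) -
            ∑ l ∈ Finset.Icc 1 p, jjf j l) *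
        qB q (L : ℤ) (jjf j ν) * ∏ l ∈ Finset.Icc 2 ν, qB q (jjf j l) (jjf j (l - 1))
    else 0

/-- The polynomial `W^ν_{s,b}(L,q)` of Warnaar type. -/
def W {F : Type*} [Field F] (ν : ℕ) (s : ℤ) (b L : ℕ) (q : F) : F :=
  ∑ᶠ j : ℤ,
    (q ^ (j * ((2 * j + 1) * (2 * (ν : ℤ) + 3) - 2 * s)) *
        qMulti ν L (((ν : ℤ) * ((L : ℤ) + 1) - s - b + 1) / 2 + (2 * (ν : ℤ) + 3) * j) b q -
      q ^ ((2 * j + 1) * ((2 * (ν : ℤ) + 3) * j + s)) *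
        qMulti ν L (((ν : ℤ) * ((L : ℤ) + 1) + s - b + 1) / 2 + (2 * (ν : ℤ) + 3) * j) b q)

/-! ### Bressoud lattice paths -/

/-- Step values: `0 ↦ NE (+1)`, `1 ↦ SE (−1)`, `2 ↦ horizontal (0)`. -/
def stepVal : Fin 3 → ℤ := ![1, -1, 0]

/-- Height of the path after `k` steps, starting at height `s`. -/
def hts (s : ℤ) {n : ℕ} (d : Fin n → Fin 3) (k : ℕ) : ℤ :=
  s + ∑ i ∈ Finset.range k, if h : i < n then stepVal (d ⟨i, h⟩) else 0

/-- The vertex `k` is a peak: it is preceded by a NE step and followed by a SE step. -/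
def IsPeak {n : ℕ} (d : Fin n → Fin 3) (k : ℕ) : Prop :=
  ∃ hk : k < n, 1 ≤ k ∧ d ⟨k - 1, Nat.lt_of_le_of_lt (Nat.sub_le k 1) hk⟩ = 0 ∧ d ⟨k, hk⟩ = 1

/-- `d` encodes a Bressoud path from height `s` to height `b` whose peaks have height `≤ ν`:
SE steps only from positive height, horizontal steps only on the x-axis. -/
def ValidPath (ν : ℕ) (s b : ℤ) {n : ℕ} (d : Fin n → Fin 3) : Prop :=
  hts s d n = b ∧
    (∀ k : Fin n, (d k = 1 → 0 < hts s d (k : ℕ)) ∧ (d k = 2 → hts s d (k : ℕ) = 0)) ∧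
    (∀ k : ℕ, IsPeak d k → hts s d k ≤ (ν : ℤ))

/-- The weight of a Bressoud path starting at x-coordinate `M`:
the sum of the x-coordinates of its peaks. -/
def pwt (M : ℤ) {n : ℕ} (d : Fin n → Fin 3) : ℤ :=
  ∑ k ∈ Finset.range (n + 1), if IsPeak d k then M + (k : ℤ) else 0

/-- `C^ν_{M,L}(s,b,q)`: the weighted count of Bressoud paths from `(M,s)` to `(L,b)`
with no peak higher than `ν`. -/
def Cpoly {F : Type*} [Field F] (ν : ℕ) (M L : ℤ) (s b : ℕ) (q : F) : F :=
  ∑ d ∈ Finset.univ.filter (fun d : Fin (L - M).toNat → Fin 3 => ValidPath ν (s : ℤ) (b : ℤ) d),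
    q ^ pwt M d

/-- `t` is an admissible relative height for the peak at vertex `k`. -/
def RelProp (s : ℤ) {n : ℕ} (d : Fin n → Fin 3) (k t : ℕ) : Prop :=
  0 < t ∧ ∃ k' k'' : ℕ, k' < k ∧ k < k'' ∧ k'' ≤ n ∧
    hts s d k' = hts s d k - t ∧ hts s d k'' = hts s d k - t ∧
    ∀ m : ℕ, k' < m → m < k'' → IsPeak d m →
      hts s d m ≤ hts s d k ∧ (hts s d m = hts s d k → k ≤ m)

/-- The relative height of the peak at vertex `k`: the largest `t` with `RelProp`. -/
def relHt (ν : ℕ) (s : ℤ) {n : ℕ} (d : Fin n → Fin 3) (k : ℕ) : ℕ :=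
  Nat.findGreatest (RelProp s d k) (ν + n)

/-- `P^ν_{M,L}(s,b,n)`: Bressoud paths from `(M,s)` to `(L,b)`, peaks of height at most `ν`,
with exactly `nn j` peaks of relative height `j+1`. -/
def Pset (ν : ℕ) (M L : ℤ) (s b : ℤ) (nn : Fin ν → ℕ) : Finset (Fin (L - M).toNat → Fin 3) :=
  Finset.univ.filter (fun d => ValidPath ν s b d ∧
    ∀ j : Fin ν, ((Finset.range ((L - M).toNat + 1)).filter
      (fun k => IsPeak d k ∧ relHt ν s d k = (j : ℕ) + 1)).card = nn j)

/-! ### Gordon lattice paths -/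

/-- `f` encodes a Gordon path of length `n` from height `s` to height `b`:
`f 0 = s`, `f n = b`, adjacent frequencies sum to at most `ν`; values beyond `n` are `0`. -/
def IsGordon (ν n s b : ℕ) (f : ℕ → ℕ) : Prop :=
  f 0 = s ∧ f n = b ∧ (∀ k, k < n → f k + f (k + 1) ≤ ν) ∧ (∀ k, n < k → f k = 0)

/-- The weight `Σ_{j=M+1}^{L-1} j f_j` of a Gordon path starting at x-coordinate `M`. -/
def gwt (M : ℤ) (n : ℕ) (f : ℕ → ℕ) : ℤ :=
  ∑ k ∈ Finset.Ioo 0 n, (M + (k : ℤ)) * (f k : ℤ)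

/-- `G^ν_{M,L}(s,b,q)`: the weighted count of Gordon paths from `(M,s)` to `(L,b)`. -/
def G {F : Type*} [Field F] (ν : ℕ) (M L : ℤ) (s b : ℕ) (q : F) : F :=
  ∑ᶠ f : ℕ → ℕ, if IsGordon ν (L - M).toNat s b f then q ^ gwt M (L - M).toNat f else 0

/-- `F^ν_{s,b}(L,q)` of (2.21). -/
def Fpoly {F : Type*} [Field F] (ν s b L : ℕ) (q : F) : F :=
  ∑ᶠ nn : Fin ν → ℕ, q ^ expAG ν s nn *
    ∏ i : Fin ν, qB q ((nn i : ℤ) + ((i : ℕ) + 1) * (L : ℤ) -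
      2 * (∑ l ∈ Finset.Icc 1 ((i : ℕ) + 1), (NN nn l : ℤ)) -
      alph ((i : ℕ) + 1) s - alph ((i : ℕ) + 1) b) (nn i)

/-- The left-hand side of (4.2): `F` with the extra `−M(N_1+⋯+N_ν)` in the exponent. -/
def FpolyM {F : Type*} [Field F] (ν s b L M : ℕ) (q : F) : F :=
  ∑ᶠ nn : Fin ν → ℕ,
    q ^ ((expAG ν s nn : ℤ) - (M : ℤ) * ∑ i ∈ Finset.Icc 1 ν, (NN nn i : ℤ)) *
    ∏ i : Fin ν, qB q ((nn i : ℤ) + ((i : ℕ) + 1) * (L : ℤ) -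
      2 * (∑ l ∈ Finset.Icc 1 ((i : ℕ) + 1), (NN nn l : ℤ)) -
      alph ((i : ℕ) + 1) s - alph ((i : ℕ) + 1) b) (nn i)


abbrev K : Type := RatFunc ℚ


/-! ### Helper lemmas for the Andrews–Gordon identities -/

/-- `1/(q)_m`, extended by zero to negative integers. -/
def iq (q : ℂ) (m : ℤ) : ℂ := if 0 ≤ m then (qP q m.toNat)⁻¹ else 0

lemma one_sub_pow_ne {q : ℂ} (hq : ‖q‖ < 1) (n : ℕ) : 1 - q ^ (n + 1) ≠ 0 := by
  intro h
  have h1 : q ^ (n + 1) = 1 := (sub_eq_zero.mp h).symm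
  have h2 : ‖q‖ ^ (n + 1) = 1 := by rw [← norm_pow, h1, norm_one]
  have h3 : ‖q‖ ^ (n + 1) < 1 := pow_lt_one₀ (norm_nonneg _) hq (by omega)
  linarith

lemma qP_ne {q : ℂ} (hq : ‖q‖ < 1) (n : ℕ) : qP q n ≠ 0 :=
  Finset.prod_ne_zero_iff.mpr fun j _ => one_sub_pow_ne hq j

lemma qP_succ (q : ℂ) (n : ℕ) : qP q (n + 1) = qP q n * (1 - q ^ (n + 1)) := by
  simp [qP, Finset.prod_range_succ]

lemma iq_nat (q : ℂ) (n : ℕ) : iq q n = (qP q n)⁻¹ := by simp [iq]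

lemma iq_zero (q : ℂ) : iq q 0 = 1 := by simp [iq, qP]

lemma iq_neg (q : ℂ) {m : ℤ} (h : m < 0) : iq q m = 0 := by
  simp [iq, not_le.mpr h]

lemma iq_rec {q : ℂ} (hq : ‖q‖ < 1) (m : ℤ) : (1 - q ^ m) * iq q m = iq q (m - 1) := by
  rcases lt_trichotomy m 0 with h | h | h
  · rw [iq_neg q h, iq_neg q (by omega), mul_zero]
  · subst h; rw [iq_neg q (show (0 : ℤ) - 1 < 0 by norm_num)]; simp
  · obtain ⟨n, rfl⟩ : ∃ n : ℕ, m = (n : ℤ) + 1 := ⟨(m - 1).toNat, by omega⟩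
    have h1 : iq q ((n : ℤ) + 1) = (qP q (n + 1))⁻¹ := by
      have := iq_nat q (n + 1); push_cast at this; exact this
    have h2 : q ^ ((n : ℤ) + 1) = q ^ (n + 1) := by
      rw [← zpow_natCast]; push_cast; rfl
    rw [add_sub_cancel_right, iq_nat, h1, h2, qP_succ]
    have := one_sub_pow_ne hq n
    have := qP_ne hq n
    field_simp

lemma summable_geo {q : ℂ} (hq : ‖q‖ < 1) : Summable fun n : ℕ => ‖-q ^ (n + 1)‖ := by
  simp only [norm_neg, norm_pow]
  exact (summable_nat_add_iff 1).mpr (summable_geometric_of_lt_one (norm_nonneg _) hq)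

/-- `(q)_∞`. -/
def qInf (q : ℂ) : ℂ := ∏' n : ℕ, (1 - q ^ (n + 1))

lemma qInf_ne {q : ℂ} (hq : ‖q‖ < 1) : qInf q ≠ 0 := by
  have := tprod_one_add_ne_zero_of_summable (f := fun n : ℕ => -q ^ (n + 1))
    (fun n => by simpa [sub_eq_add_neg] using one_sub_pow_ne hq n) (summable_geo hq)
  simpa [qInf, sub_eq_add_neg] using this

lemma mult_q {q : ℂ} (hq : ‖q‖ < 1) : Multipliable fun n : ℕ => (1 - q ^ (n + 1)) := by
  have := multipliable_one_add_of_summable (f := fun n : ℕ => -q ^ (n + 1)) (summable_geo hq)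
  simpa [sub_eq_add_neg] using this

lemma qP_tendsto {q : ℂ} (hq : ‖q‖ < 1) :
    Filter.Tendsto (qP q) Filter.atTop (nhds (qInf q)) :=
  (mult_q hq).tendsto_prod_tprod_nat

lemma iq_tendsto {q : ℂ} (hq : ‖q‖ < 1) :
    Filter.Tendsto (fun n : ℕ => iq q n) Filter.atTop (nhds (qInf q)⁻¹) := by
  simp only [iq_nat]
  exact (qP_tendsto hq).inv₀ (qInf_ne hq)

lemma iq_tendsto' {q : ℂ} (hq : ‖q‖ < 1) (a : ℤ) :
    Filter.Tendsto (fun n : ℕ => iq q (n + a)) Filter.atTop (nhds (qInf q)⁻¹) := by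
  have h : Filter.Tendsto (fun n : ℕ => ((n : ℤ) + a).toNat) Filter.atTop Filter.atTop := by
    rw [Filter.tendsto_atTop]
    intro b
    filter_upwards [Filter.eventually_ge_atTop (b + a.natAbs)] with n hn
    omega
  refine ((iq_tendsto hq).comp h).congr' ?_
  filter_upwards [Filter.eventually_ge_atTop (a.natAbs)] with n hn
  simp only [Function.comp]
  congr 1
  omega

lemma iq_bdd {q : ℂ} (hq : ‖q‖ < 1) : ∃ C : ℝ, 1 ≤ C ∧ ∀ m, ‖iq q m‖ ≤ C := by
  obtain ⟨C, hC⟩ := (iq_tendsto hq).norm.bddAbove_range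
  have h0 : ∀ n : ℕ, ‖iq q n‖ ≤ C := fun n => hC ⟨n, rfl⟩
  have h1 : 1 ≤ C := by simpa [iq_zero] using h0 0
  refine ⟨C, h1, fun m => ?_⟩
  by_cases h : 0 ≤ m
  · lift m to ℕ using h; exact h0 m
  · rw [iq_neg q (by omega), norm_zero]; linarith

/-- q-Vandermonde. -/
lemma qVand {q : ℂ} (hq : ‖q‖ < 1) (h0 : q ≠ 0) (M : ℕ) : ∀ c : ℕ,
    ∑ m ∈ Finset.range (M + 1), q ^ (m * (m + c)) *
      (iq q ((M : ℤ) - m) * iq q m * iq q ((m : ℤ) + c)) = iq q M * iq q ((M : ℤ) + c) := by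
  induction M with
  | zero => intro c; simp [iq_zero]
  | succ M ih =>
    intro c
    have hne := one_sub_pow_ne hq M
    apply mul_left_cancel₀ hne
    have e1 : ∀ m : ℕ, (1 - q ^ (M + 1)) * (q ^ (m * (m + c)) *
        (iq q (((M + 1 : ℕ) : ℤ) - m) * iq q m * iq q ((m : ℤ) + c))) =
        q ^ (m * (m + c)) * (iq q ((M : ℤ) - m) * iq q m * iq q ((m : ℤ) + c)) +
        q ^ ((m : ℤ) * (m + c) + (M + 1 - m)) * (iq q ((M : ℤ) + 1 - m) * iq q ((m : ℤ) - 1) *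
          iq q ((m : ℤ) + c)) := by
      intro m
      have a1 := iq_rec hq ((M : ℤ) + 1 - m)
      have a2 := iq_rec hq (m : ℤ)
      rw [show (M : ℤ) + 1 - m - 1 = M - m by ring] at a1
      rw [← a1, ← a2]
      have b1 : q ^ ((m : ℤ) * (m + c) + (M + 1 - m)) = q ^ (m * (m + c)) * q ^ ((M : ℤ) + 1 - m) := by
        rw [zpow_add₀ h0, ← zpow_natCast q (m * (m + c))]; push_cast; rfl
      have b2 : q ^ (M + 1) = q ^ ((M : ℤ) + 1 - m) * q ^ (m : ℤ) := by
        rw [← zpow_add₀ h0, ← zpow_natCast]; congr 1; push_cast; ring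
      rw [b1, b2]; push_cast; ring
    rw [Finset.mul_sum, Finset.sum_congr rfl fun m _ => e1 m, Finset.sum_add_distrib,
      Finset.sum_range_succ, Finset.sum_range_succ' (fun m : ℕ => q ^ ((m : ℤ) * (m + c) + (M + 1 - m)) *
        (iq q ((M : ℤ) + 1 - m) * iq q ((m : ℤ) - 1) * iq q ((m : ℤ) + c)))]
    rw [iq_neg q (show (M : ℤ) - ((M + 1 : ℕ) : ℤ) < 0 by push_cast; omega),
      iq_neg q (show ((0 : ℕ) : ℤ) - 1 < 0 by norm_num), ih c]
    have e2 : ∀ m : ℕ, q ^ (((m + 1 : ℕ) : ℤ) * ((m + 1 : ℕ) + c) + (M + 1 - (m + 1 : ℕ))) *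
        (iq q ((M : ℤ) + 1 - (m + 1 : ℕ)) * iq q (((m + 1 : ℕ) : ℤ) - 1) *
          iq q (((m + 1 : ℕ) : ℤ) + c)) =
        q ^ (M + 1 + c) * (q ^ (m * (m + (c + 1))) * (iq q ((M : ℤ) - m) * iq q m *
          iq q ((m : ℤ) + (c + 1 : ℕ)))) := by
      intro m
      rw [← mul_assoc (q ^ (M + 1 + c)), ← pow_add, ← zpow_natCast]
      rw [show (M : ℤ) + 1 - (m + 1 : ℕ) = M - m by push_cast; ring,
        show ((m + 1 : ℕ) : ℤ) - 1 = m by push_cast; ring,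
        show ((m + 1 : ℕ) : ℤ) + c = m + (c + 1 : ℕ) by push_cast; ring]
      congr 2
      push_cast; ring
    rw [Finset.sum_congr rfl fun m _ => e2 m, ← Finset.mul_sum, ih (c + 1)]
    have a1 := iq_rec hq ((M : ℤ) + 1 + c)
    have a2 := iq_rec hq ((M : ℤ) + 1)
    rw [show (M : ℤ) + 1 + c - 1 = M + c by ring] at a1
    rw [show (M : ℤ) + 1 - 1 = M by ring] at a2
    have b1 : q ^ ((M : ℤ) + 1 + c) = q ^ (M + 1 + c) := by
      rw [← zpow_natCast]; push_cast; rfl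
    have b2 : q ^ ((M : ℤ) + 1) = q ^ (M + 1) := by
      rw [← zpow_natCast]; push_cast; rfl
    rw [b1] at a1
    rw [b2] at a2
    rw [← a1, ← a2]
    push_cast
    rw [show (M : ℤ) + (c + 1) = M + 1 + c by ring]
    ring

lemma step_nn {q : ℂ} (hq : ‖q‖ < 1) (h0 : q ≠ 0) (e N ρ : ℕ) :
    ∑ n ∈ Finset.range (N + 1), q ^ (n ^ 2 + e * n) * iq q ((N : ℤ) - n) *
      (iq q ((n : ℤ) - ρ) * iq q ((n : ℤ) + ρ + e)) =
    q ^ (ρ ^ 2 + e * ρ) * (iq q ((N : ℤ) - ρ) * iq q ((N : ℤ) + ρ + e)) := by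
  by_cases h : ρ ≤ N
  · obtain ⟨M, rfl⟩ := Nat.exists_eq_add_of_le h
    rw [show ρ + M + 1 = ρ + (M + 1) by ring, Finset.sum_range_add, Finset.sum_eq_zero, zero_add]
    · have := qVand hq h0 M (2 * ρ + e)
      rw [show ((ρ + M : ℕ) : ℤ) - ρ = M by push_cast; ring,
        show ((ρ + M : ℕ) : ℤ) + ρ + e = M + (2 * ρ + e : ℕ) by push_cast; ring, ← this,
        Finset.mul_sum]
      refine Finset.sum_congr rfl fun m _ => ?_
      rw [show ((ρ + M : ℕ) : ℤ) - (ρ + m : ℕ) = M - m by push_cast; ring,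
        show ((ρ + m : ℕ) : ℤ) - ρ = m by push_cast; ring,
        show ((ρ + m : ℕ) : ℤ) + ρ + e = m + (2 * ρ + e : ℕ) by push_cast; ring]
      rw [show (ρ + m) ^ 2 + e * (ρ + m) = (ρ ^ 2 + e * ρ) + m * (m + (2 * ρ + e)) by ring, pow_add]
      ring
    · intro n hn
      rw [iq_neg q (show (n : ℤ) - ρ < 0 by have := Finset.mem_range.mp hn; omega)]
      ring
  · rw [iq_neg q (show (N : ℤ) - ρ < 0 by omega), Finset.sum_eq_zero]
    · ring
    · intro n hn
      rw [iq_neg q (show (n : ℤ) - ρ < 0 by have := Finset.mem_range.mp hn; omega)]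
      ring

lemma step_int {q : ℂ} (hq : ‖q‖ < 1) (h0 : q ≠ 0) (e N : ℕ) (he : e ≤ 1) (r : ℤ) :
    ∑ n ∈ Finset.range (N + 1), q ^ (n ^ 2 + e * n) * iq q ((N : ℤ) - n) *
      (iq q ((n : ℤ) - r) * iq q ((n : ℤ) + r + e)) =
    q ^ (r ^ 2 + e * r) * (iq q ((N : ℤ) - r) * iq q ((N : ℤ) + r + e)) := by
  by_cases h : 0 ≤ r
  · lift r to ℕ using h
    rw [step_nn hq h0, ← zpow_natCast]; push_cast; rfl
  · obtain ⟨ρ, hρ⟩ : ∃ ρ : ℕ, r = - ρ - e := ⟨(-r - e).toNat, by omega⟩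
    subst hρ
    have := step_nn hq h0 e N ρ
    simp only [show ∀ x : ℤ, x - (-(ρ : ℤ) - e) = x + ρ + e by intro x; ring,
      show ∀ x : ℤ, x + (-(ρ : ℤ) - e) + e = x - ρ by intro x; ring]
    simp only [mul_comm (iq q (_ + (ρ : ℤ) + e))]
    rw [this, ← zpow_natCast]
    congr 2
    push_cast; ring

/-- Bilateral Bailey transform. -/
def AGX (q : ℂ) (e : ℕ) (g : ℤ → ℂ) (N : ℤ) : ℂ :=
  ∑' r : ℤ, g r * (iq q (N - r) * iq q (N + r + e))

lemma fin_supp (q : ℂ) (g : ℤ → ℂ) (a b : ℤ) :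
    (Function.support fun r : ℤ => g r * (iq q (a - r) * iq q (b + r))).Finite := by
  refine (Set.finite_Icc (-b) a).subset fun r hr => ?_
  rw [Function.mem_support] at hr
  by_contra hc
  apply hr
  rw [Set.mem_Icc, not_and_or] at hc
  rcases hc with hc | hc
  · rw [iq_neg q (show b + r < 0 by omega)]; ring
  · rw [iq_neg q (show a - r < 0 by omega)]; ring

lemma summ_X (q : ℂ) (g : ℤ → ℂ) (a b : ℤ) :
    Summable fun r : ℤ => g r * (iq q (a - r) * iq q (b + r)) :=
  summable_of_hasFiniteSupport (fin_supp q g a b)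

lemma summ_X' (q : ℂ) (g : ℤ → ℂ) (a b : ℤ) (e : ℕ) :
    Summable fun r : ℤ => g r * (iq q (a - r) * iq q (b + r + e)) := by
  have := summ_X q g a (b + e)
  simpa only [show ∀ r : ℤ, b + r + e = b + e + r by intro r; ring] using this

lemma bailey {q : ℂ} (hq : ‖q‖ < 1) (h0 : q ≠ 0) (e N : ℕ) (he : e ≤ 1) (g : ℤ → ℂ) :
    ∑ n ∈ Finset.range (N + 1), q ^ (n ^ 2 + e * n) * iq q ((N : ℤ) - n) * AGX q e g n =
    AGX q e (fun r => q ^ (r ^ 2 + e * r) * g r) N := by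
  simp only [AGX, ← tsum_mul_left]
  rw [← Summable.tsum_finsetSum (f := fun (n : ℕ) (r : ℤ) => q ^ (n ^ 2 + e * n) * iq q ((N : ℤ) - n) *
    (g r * (iq q (n - r) * iq q (n + r + e)))) fun n _ => (summ_X' q g n n e).mul_left _]
  refine tsum_congr fun r => ?_
  rw [mul_right_comm, ← step_int hq h0 e N he r, Finset.sum_mul]
  refine Finset.sum_congr rfl fun n _ => by ring

lemma AGconvert {q : ℂ} (hq : ‖q‖ < 1) (h0 : q ≠ 0) (g : ℤ → ℂ)
    (hg : ∀ r, g (-1 - r) = - q ^ (2 * r + 1) * g r) (N : ℤ) : AGX q 1 g N = AGX q 0 g N := by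
  have h1 : ∀ r : ℤ, g r * (iq q (N - r) * iq q (N + r + (0 : ℕ))) =
      g r * (iq q (N - r) * iq q (N + r + (1 : ℕ))) -
      q ^ (N + r + 1) * g r * (iq q (N - r) * iq q (N + r + (1 : ℕ))) := by
    intro r
    have := iq_rec hq (N + r + 1)
    push_cast
    rw [add_sub_cancel_right] at this
    rw [add_zero, ← this]; ring
  unfold AGX
  rw [tsum_congr h1, Summable.tsum_sub (summ_X' q g N N 1)
    (summ_X' q (fun r => q ^ (N + r + 1) * g r) N N 1)]
  set S := ∑' r : ℤ, q ^ (N + r + 1) * g r * (iq q (N - r) * iq q (N + r + (1 : ℕ))) with hS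
  have h2 : S = -S := by
    conv_lhs => rw [hS, ← (Equiv.subLeft (-1 : ℤ)).tsum_eq]
    rw [hS, ← tsum_neg]
    refine tsum_congr fun r => ?_
    simp only [Equiv.subLeft_apply, hg]
    rw [show N - (-1 - r) = N + r + (1 : ℕ) by push_cast; ring,
      show N + (-1 - r) + (1 : ℕ) = N - r by push_cast; ring,
      show N + r + 1 = (N + (-1 - r) + 1) + (2 * r + 1) by ring,
      zpow_add₀ h0 (N + (-1 - r) + 1)]
    ring
  have h3 : S = 0 := by
    have : (2 : ℂ) * S = 0 := by linear_combination h2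
    simpa using this
  rw [h3, sub_zero]

/-- `(-1)^r q^{r(r-1)/2}` -/
def wt (q : ℂ) (r : ℤ) : ℂ := (-1) ^ r * q ^ (r * (r - 1) / 2)

lemma tri (r : ℤ) : 2 * (r * (r - 1) / 2) = r * (r - 1) :=
  Int.mul_ediv_cancel' (Int.even_mul_pred_self r).two_dvd

lemma wt_succ {q : ℂ} (h0 : q ≠ 0) (r : ℤ) : wt q (r + 1) = - q ^ r * wt q r := by
  have h : (r + 1) * (r + 1 - 1) / 2 = r + r * (r - 1) / 2 := by
    have h1 := tri r
    have h2 := tri (r + 1)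
    nlinarith
  unfold wt
  rw [h, zpow_add₀ h0, zpow_add₀ (by norm_num : (-1 : ℂ) ≠ 0), zpow_one]; ring

lemma wt_zero (q : ℂ) : wt q 0 = 1 := by simp [wt]

lemma wt_refl {q : ℂ} (h0 : q ≠ 0) (r : ℤ) : wt q (-1 - r) = - q ^ (2 * r + 1) * wt q r := by
  have h : (-1 - r) * (-1 - r - 1) / 2 = 2 * r + 1 + r * (r - 1) / 2 := by
    have h1 := tri r
    have h2 := tri (-1 - r)
    nlinarith
  unfold wt
  rw [h, zpow_add₀ h0, zpow_sub₀ (by norm_num : (-1 : ℂ) ≠ 0)]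
  have : ((-1 : ℂ) ^ r)⁻¹ = (-1) ^ r := by rw [← inv_zpow]; norm_num
  rw [div_eq_mul_inv, this]; norm_num; ring

/-- finite Jacobi triple product sums -/
def AGA (q z : ℂ) (a b : ℤ) : ℂ :=
  ∑' r : ℤ, wt q r * z ^ r * (iq q (a - r) * iq q (b + r))

lemma AGA_left {q z : ℂ} (hq : ‖q‖ < 1) (h0 : q ≠ 0) (hz : z ≠ 0) (a b : ℤ) :
    (1 - q ^ (a + b + 1)) * AGA q z (a + 1) b = (1 - z * q ^ a) * AGA q z a b := by
  have h1 : ∀ r : ℤ, (1 - q ^ (a + b + 1)) *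
      (wt q r * z ^ r * (iq q (a + 1 - r) * iq q (b + r))) =
      wt q r * z ^ r * (iq q (a - r) * iq q (b + r)) +
      (wt q r * z ^ r * q ^ (a + 1 - r)) * (iq q (a + 1 - r) * iq q (b - 1 + r)) := by
    intro r
    have a1 := iq_rec hq (a + 1 - r)
    have a2 := iq_rec hq (b + r)
    rw [show a + 1 - r - 1 = a - r by ring] at a1
    rw [show b + r - 1 = b - 1 + r by ring] at a2
    rw [← a1, ← a2, show a + b + 1 = (a + 1 - r) + (b + r) by ring, zpow_add₀ h0]
    ring
  unfold AGA
  rw [← tsum_mul_left, tsum_congr h1, Summable.tsum_add (summ_X _ _ _ _) (summ_X _ _ _ _), sub_mul,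
    one_mul, sub_eq_add_neg (∑' r : ℤ, wt q r * z ^ r * (iq q (a - r) * iq q (b + r)))]
  congr 1
  rw [← (Equiv.addRight (1 : ℤ)).tsum_eq, ← tsum_mul_left, ← tsum_neg]
  refine tsum_congr fun r => ?_
  simp only [Equiv.coe_addRight]
  rw [wt_succ h0, zpow_add₀ hz, show a + 1 - (r + 1) = a - r by ring,
    show b - 1 + (r + 1) = b + r by ring, zpow_sub₀ h0]
  have := zpow_ne_zero r h0
  field_simp

lemma AGA_right {q z : ℂ} (hq : ‖q‖ < 1) (h0 : q ≠ 0) (hz : z ≠ 0) (a b : ℤ) :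
    (1 - q ^ (a + b + 1)) * AGA q z a (b + 1) = (1 - q ^ (b + 1) / z) * AGA q z a b := by
  have h1 : ∀ r : ℤ, (1 - q ^ (a + b + 1)) *
      (wt q r * z ^ r * (iq q (a - r) * iq q (b + 1 + r))) =
      wt q r * z ^ r * (iq q (a - r) * iq q (b + r)) +
      (wt q r * z ^ r * q ^ (b + 1 + r)) * (iq q (a - 1 - r) * iq q (b + 1 + r)) := by
    intro r
    have a1 := iq_rec hq (a - r)
    have a2 := iq_rec hq (b + 1 + r)
    rw [show a - r - 1 = a - 1 - r by ring] at a1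
    rw [show b + 1 + r - 1 = b + r by ring] at a2
    rw [← a1, ← a2, show a + b + 1 = (a - r) + (b + 1 + r) by ring, zpow_add₀ h0]
    ring
  unfold AGA
  rw [← tsum_mul_left, tsum_congr h1, Summable.tsum_add (summ_X _ _ _ _) (summ_X _ _ _ _), sub_mul,
    one_mul, sub_eq_add_neg (∑' r : ℤ, wt q r * z ^ r * (iq q (a - r) * iq q (b + r)))]
  congr 1
  rw [← (Equiv.addRight (1 : ℤ)).tsum_eq (fun r => wt q r * z ^ r * (iq q (a - r) * iq q (b + r))),
    ← tsum_mul_left, ← tsum_neg]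
  refine tsum_congr fun r => ?_
  simp only [Equiv.coe_addRight]
  rw [wt_succ h0, zpow_add₀ hz, show a - (r + 1) = a - 1 - r by ring,
    show b + (r + 1) = b + 1 + r by ring, zpow_add₀ h0 (b + 1)]
  field_simp

lemma AGA_zero (q z : ℂ) : AGA q z 0 0 = 1 := by
  unfold AGA
  rw [tsum_eq_single 0]
  · simp [wt_zero, iq_zero]
  · intro r hr
    rcases lt_or_gt_of_ne hr with h | h
    · rw [iq_neg q (show 0 + r < 0 by omega)]; ring
    · rw [iq_neg q (show 0 - r < 0 by omega)]; ring

lemma AGA_prod {q z : ℂ} (hq : ‖q‖ < 1) (h0 : q ≠ 0) (hz : z ≠ 0) (n : ℕ) :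
    qP q (2 * n) * AGA q z n n =
      (∏ j ∈ Finset.range n, (1 - z * q ^ j)) * ∏ j ∈ Finset.range n, (1 - q ^ (j + 1) / z) := by
  induction n with
  | zero => simp [AGA_zero, qP]
  | succ n ih =>
    rw [Finset.prod_range_succ, Finset.prod_range_succ, show 2 * (n + 1) = 2 * n + 1 + 1 by ring,
      qP_succ, qP_succ]
    have l := AGA_left hq h0 hz n n
    have r := AGA_right hq h0 hz (n + 1) n
    rw [show (n : ℤ) + n + 1 = (2 * n + 1 : ℕ) by push_cast; ring, zpow_natCast, zpow_natCast] at l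
    rw [show (n : ℤ) + 1 + n + 1 = (2 * n + 1 + 1 : ℕ) by push_cast; ring,
      show (n : ℤ) + 1 = (n + 1 : ℕ) by push_cast; ring, zpow_natCast, zpow_natCast] at r
    push_cast at l r ⊢
    linear_combination (1 - z * q ^ n) * (1 - q ^ (n + 1) / z) * ih +
      qP q (2 * n) * (1 - q ^ (2 * n + 1)) * r + qP q (2 * n) * (1 - q ^ (n + 1) / z) * l

lemma unitX {q : ℂ} (hq : ‖q‖ < 1) (h0 : q ≠ 0) (n : ℕ) :
    AGX q 1 (wt q) n = if n = 0 then 1 else 0 := by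
  rw [AGconvert hq h0 _ (wt_refl h0)]
  have h : AGX q 0 (wt q) n = AGA q 1 n n := by simp [AGX, AGA]
  have h2 := AGA_prod hq h0 one_ne_zero n
  rw [h]
  split_ifs with hn
  · subst hn; exact_mod_cast AGA_zero q 1
  · have h3 : ∏ j ∈ Finset.range n, (1 - 1 * q ^ j) = 0 :=
      Finset.prod_eq_zero (Finset.mem_range.mpr (Nat.pos_of_ne_zero hn)) (by simp)
    rw [h3, zero_mul] at h2
    exact (mul_eq_zero.mp h2).resolve_left (qP_ne hq _)

lemma NN_one {ν : ℕ} (t : Fin ν → ℕ) : NN t 1 = ∑ k, t k := by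
  simp [NN]

lemma NN_cons_one {ν : ℕ} (a : ℕ) (t : Fin ν → ℕ) :
    NN (Fin.cons a t : Fin (ν + 1) → ℕ) 1 = a + NN t 1 := by
  simp [NN_one, Fin.sum_univ_succ]

lemma NN_cons_succ {ν : ℕ} (a : ℕ) (t : Fin ν → ℕ) (i : ℕ) (hi : 1 ≤ i) :
    NN (Fin.cons a t : Fin (ν + 1) → ℕ) (i + 1) = NN t i := by
  have : i ≠ 0 := by omega
  simp [NN, Fin.sum_univ_succ, this]

lemma sum_shift (f : ℕ → ℕ) (a b : ℕ) :
    ∑ i ∈ Finset.Icc (a + 1) (b + 1), f i = ∑ i ∈ Finset.Icc a b, f (i + 1) := by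
  rw [← Finset.map_add_right_Icc, Finset.sum_map]; rfl

lemma sum_first (f : ℕ → ℕ) (b : ℕ) :
    ∑ i ∈ Finset.Icc 1 (b + 1), f i = f 1 + ∑ i ∈ Finset.Icc 1 b, f (i + 1) := by
  rw [← sum_shift, ← Finset.insert_Icc_add_one_left_eq_Icc (by omega : 1 ≤ b + 1),
    Finset.sum_insert (by simp)]

lemma sum_NN_cons {ν : ℕ} (a : ℕ) (t : Fin ν → ℕ) (p c : ℕ) (hc : 1 ≤ c) :
    ∑ i ∈ Finset.Icc c ν, (NN (Fin.cons a t : Fin (ν + 1) → ℕ) (i + 1)) ^ p =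
    ∑ i ∈ Finset.Icc c ν, (NN t i) ^ p :=
  Finset.sum_congr rfl fun i hi => by
    rw [NN_cons_succ a t i (hc.trans (Finset.mem_Icc.mp hi).1)]

lemma exp_cons_succ {ν : ℕ} (s a : ℕ) (t : Fin ν → ℕ) :
    expAG (ν + 1) (s + 1) (Fin.cons a t) =
      ((a + NN t 1) ^ 2 + 0 * (a + NN t 1)) + expAG ν s t := by
  have h := sum_NN_cons a t 1 (s + 1) (by omega)
  simp only [pow_one] at h
  unfold expAG
  rw [sum_first, sum_shift, NN_cons_one, sum_NN_cons a t 2 1 le_rfl, h]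
  ring

lemma exp_cons_zero {ν : ℕ} (a : ℕ) (t : Fin ν → ℕ) :
    expAG (ν + 1) 0 (Fin.cons a t) =
      ((a + NN t 1) ^ 2 + 1 * (a + NN t 1)) + expAG ν 0 t := by
  have h := sum_NN_cons a t 1 1 (by omega)
  simp only [pow_one] at h
  unfold expAG
  rw [sum_first, zero_add, sum_first, NN_cons_one, sum_NN_cons a t 2 1 le_rfl, h]
  ring

lemma exp_ge {ν : ℕ} (s : ℕ) (t : Fin ν → ℕ) : ∑ k, t k ≤ expAG ν s t := by
  refine le_trans ?_ (Nat.le_add_right _ _)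
  induction ν with
  | zero => simp
  | succ ν ih =>
    have h : t = Fin.cons (t 0) (Fin.tail t) := (Fin.cons_self_tail t).symm
    rw [h, sum_first, sum_NN_cons _ _ 2 1 le_rfl, NN_cons_one, Fin.sum_univ_succ]
    simp only [Fin.cons_zero, Fin.cons_succ]
    have := ih (Fin.tail t)
    have h3 : t 0 ≤ t 0 + NN (Fin.tail t) 1 := Nat.le_add_right _ _
    have h4 : t 0 + NN (Fin.tail t) 1 ≤ (t 0 + NN (Fin.tail t) 1) ^ 2 := Nat.le_self_pow (by norm_num) _
    omega

lemma summ_tuple {x : ℝ} (h0 : 0 ≤ x) (h1 : x < 1) (ν : ℕ) :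
    Summable fun t : Fin ν → ℕ => x ^ (∑ k, t k) := by
  induction ν with
  | zero => exact Summable.of_finite
  | succ ν ih =>
    rw [← (Fin.consEquiv fun _ : Fin (ν + 1) => ℕ).summable_iff]
    have := Summable.mul_of_nonneg (summable_geometric_of_lt_one h0 h1) ih
      (fun _ => pow_nonneg h0 _) (fun _ => pow_nonneg h0 _)
    refine this.congr fun p => ?_
    simp [Fin.consEquiv, Fin.sum_univ_succ, pow_add]

/-- finitized multisum -/
def AGG (q : ℂ) (ν s : ℕ) (N : ℤ) : ℂ :=
  ∑' t : Fin ν → ℕ, q ^ expAG ν s t * (∏ i, qP q (t i))⁻¹ * iq q (N - NN t 1)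

lemma tuple_bound {q : ℂ} (hq : ‖q‖ < 1) {C : ℝ} (hC : ∀ m, ‖iq q m‖ ≤ C)
    {ν : ℕ} (s : ℕ) (t : Fin ν → ℕ) :
    ‖q ^ expAG ν s t * (∏ i, qP q (t i))⁻¹‖ ≤ ‖q‖ ^ (∑ k, t k) * C ^ ν := by
  rw [norm_mul, norm_pow, ← Finset.prod_inv_distrib, norm_prod]
  apply mul_le_mul _ _ (Finset.prod_nonneg fun _ _ => norm_nonneg _) (pow_nonneg (norm_nonneg _) _)
  · exact pow_le_pow_of_le_one (norm_nonneg _) hq.le (exp_ge s t)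
  · calc _ ≤ ∏ i : Fin ν, C := Finset.prod_le_prod (fun _ _ => norm_nonneg _) fun i _ => by
          have := hC (t i); rwa [iq_nat] at this
      _ = C ^ ν := by simp

lemma tuple_bound' {q : ℂ} (hq : ‖q‖ < 1) {C : ℝ} (hC1 : 1 ≤ C) (hC : ∀ m, ‖iq q m‖ ≤ C)
    {ν : ℕ} (s : ℕ) (t : Fin ν → ℕ) (m : ℤ) :
    ‖q ^ expAG ν s t * (∏ i, qP q (t i))⁻¹ * iq q m‖ ≤ ‖q‖ ^ (∑ k, t k) * C ^ ν * C := by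
  rw [norm_mul]
  exact mul_le_mul (tuple_bound hq hC s t) (hC m) (norm_nonneg _) (by positivity)

lemma summ_G {q : ℂ} (hq : ‖q‖ < 1) (ν s : ℕ) (N : ℤ) :
    Summable fun t : Fin ν → ℕ => q ^ expAG ν s t * (∏ i, qP q (t i))⁻¹ * iq q (N - NN t 1) := by
  obtain ⟨C, hC1, hC⟩ := iq_bdd hq
  exact Summable.of_norm_bounded (((summ_tuple (norm_nonneg q) hq ν).mul_right (C ^ ν)).mul_right C)
    fun t => tuple_bound' hq hC1 hC s t _

lemma AGG_rec {q : ℂ} (hq : ‖q‖ < 1) (ν s s' e : ℕ)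
    (hE : ∀ (a : ℕ) (t : Fin ν → ℕ), expAG (ν + 1) s' (Fin.cons a t) =
      ((a + NN t 1) ^ 2 + e * (a + NN t 1)) + expAG ν s t) (N : ℕ) :
    AGG q (ν + 1) s' N =
      ∑ n ∈ Finset.range (N + 1), q ^ (n ^ 2 + e * n) * iq q ((N : ℤ) - n) * AGG q ν s n := by
  simp only [AGG, ← tsum_mul_left]
  rw [← Summable.tsum_finsetSum (f := fun (n : ℕ) (t : Fin ν → ℕ) =>
    q ^ (n ^ 2 + e * n) * iq q ((N : ℤ) - n) *
    (q ^ expAG ν s t * (∏ i, qP q (t i))⁻¹ * iq q (n - NN t 1)))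
    fun n _ => (summ_G hq ν s n).mul_left _]
  let φ : (Fin ν → ℕ) × ℕ ≃ (Fin (ν + 1) → ℕ) :=
    (Equiv.prodComm _ _).trans (Fin.consEquiv fun _ : Fin (ν + 1) => ℕ)
  have hφ : ∀ p, φ p = Fin.cons p.2 p.1 := fun p => rfl
  rw [← φ.tsum_eq]
  have hs := φ.summable_iff.mpr (summ_G hq (ν + 1) s' N)
  rw [Summable.tsum_prod (f := fun p => q ^ expAG (ν + 1) s' (φ p) * (∏ i, qP q (φ p i))⁻¹ *
    iq q (N - NN (φ p) 1)) hs]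
  refine tsum_congr fun t => ?_
  set m := NN t 1 with hm
  have h1 : ∑ n ∈ Finset.range (N + 1), q ^ (n ^ 2 + e * n) * iq q ((N : ℤ) - n) *
      (q ^ expAG ν s t * (∏ i, qP q (t i))⁻¹ * iq q ((n : ℤ) - m)) =
      ∑' n : ℕ, q ^ (n ^ 2 + e * n) * iq q ((N : ℤ) - n) *
      (q ^ expAG ν s t * (∏ i, qP q (t i))⁻¹ * iq q ((n : ℤ) - m)) := by
    rw [tsum_eq_sum]
    intro n hn
    rw [iq_neg q (show (N : ℤ) - n < 0 by rw [Finset.mem_range] at hn; omega)]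
    ring
  rw [h1, ← (add_left_injective m).tsum_eq (f := fun n : ℕ => q ^ (n ^ 2 + e * n) *
    iq q ((N : ℤ) - n) * (q ^ expAG ν s t * (∏ i, qP q (t i))⁻¹ * iq q ((n : ℤ) - m)))]
  · refine tsum_congr fun a => ?_
    simp only [hφ, hE, NN_cons_one, Fin.prod_univ_succ, Fin.cons_zero, Fin.cons_succ, ← hm]
    rw [show ((a + m : ℕ) : ℤ) - m = a by push_cast; ring, iq_nat, pow_add q _ (expAG ν s t), mul_inv]
    ring
  · intro n hn
    rw [Function.mem_support] at hn
    by_contra hc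
    apply hn
    rw [iq_neg q (show (n : ℤ) - m < 0 by
      by_contra h
      exact hc ⟨n - m, by simp only; omega⟩)]
    ring

lemma AGG_zero (q : ℂ) (N : ℤ) : AGG q 0 0 N = iq q N := by
  unfold AGG
  rw [tsum_fintype]
  simp [expAG, NN]

lemma AGG_s0 {q : ℂ} (hq : ‖q‖ < 1) (h0 : q ≠ 0) (ν : ℕ) : ∀ N : ℕ,
    AGG q ν 0 N = AGX q 1 (fun r => q ^ (((ν : ℤ) + 1) * (r ^ 2 + r)) * wt q r) N := by
  induction ν with
  | zero =>
    intro N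
    have h := bailey hq h0 1 N le_rfl (wt q)
    rw [AGG_zero]
    simp only [unitX hq h0] at h
    rw [Finset.sum_eq_single 0] at h
    · simpa using h
    · intro b _ hb; simp [hb]
    · simp
  | succ ν ih =>
    intro N
    rw [AGG_rec hq ν 0 0 1 exp_cons_zero]
    simp only [ih]
    rw [bailey hq h0 1 N le_rfl]
    congr 1
    ext r
    rw [← mul_assoc, ← zpow_add₀ h0]
    congr 2
    push_cast; ring

lemma AGG_s {q : ℂ} (hq : ‖q‖ < 1) (h0 : q ≠ 0) (d s : ℕ) : ∀ N : ℕ,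
    AGG q (s + d) s N =
      AGX q 0 (fun r => q ^ (((s : ℤ) + d + 1) * r ^ 2 + (d + 1) * r) * wt q r) N := by
  induction s with
  | zero =>
    intro N
    rw [zero_add, AGG_s0 hq h0, AGconvert hq h0]
    · congr 1
      ext r
      congr 2
      push_cast; ring
    · intro r
      rw [wt_refl h0]
      rw [show ((-1 - r) ^ 2 + (-1 - r)) = r ^ 2 + r by ring]
      ring
  | succ s ih =>
    intro N
    rw [show s + 1 + d = (s + d) + 1 by ring, AGG_rec hq (s + d) s (s + 1) 0 (exp_cons_succ s)]
    simp only [ih]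
    rw [bailey hq h0 0 N (by omega)]
    congr 1
    ext r
    rw [← mul_assoc, ← zpow_add₀ h0]
    congr 2
    push_cast; ring

lemma X_limit {q : ℂ} (hq : ‖q‖ < 1) (g : ℤ → ℂ) (hg : Summable fun r => ‖g r‖) :
    Filter.Tendsto (fun N : ℕ => ∑' r : ℤ, g r * (iq q (N - r) * iq q (N + r))) Filter.atTop
      (nhds ((∑' r, g r) * ((qInf q)⁻¹ * (qInf q)⁻¹))) := by
  obtain ⟨C, hC1, hC⟩ := iq_bdd hq
  rw [← tsum_mul_right]
  refine tendsto_tsum_of_dominated_convergence (hg.mul_right (C * C)) ?_ ?_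
  · intro r
    refine Filter.Tendsto.const_mul _ (Filter.Tendsto.mul ?_ (iq_tendsto' hq r))
    simpa [sub_eq_add_neg] using iq_tendsto' hq (-r)
  · refine Filter.Eventually.of_forall fun N r => ?_
    rw [norm_mul, norm_mul]
    gcongr
    · exact hC _
    · exact hC _

lemma G_limit {q : ℂ} (hq : ‖q‖ < 1) (ν s : ℕ) :
    Filter.Tendsto (fun N : ℕ => AGG q ν s N) Filter.atTop
      (nhds ((∑' t : Fin ν → ℕ, q ^ expAG ν s t * (∏ i, qP q (t i))⁻¹) * (qInf q)⁻¹)) := by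
  obtain ⟨C, hC1, hC⟩ := iq_bdd hq
  rw [← tsum_mul_right]
  refine tendsto_tsum_of_dominated_convergence
    (((summ_tuple (norm_nonneg q) hq ν).mul_right (C ^ ν)).mul_right C) ?_ ?_
  · intro t
    refine Filter.Tendsto.const_mul _ ?_
    simpa [sub_eq_add_neg] using iq_tendsto' hq (-(NN t 1 : ℤ))
  · exact Filter.Eventually.of_forall fun N t => tuple_bound' hq hC1 hC s t _

lemma mult_geo {q : ℂ} (hq : ‖q‖ < 1) (c : ℂ) : Multipliable fun n : ℕ => (1 - c * q ^ n) := by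
  have := multipliable_one_add_of_summable (f := fun n : ℕ => -(c * q ^ n)) (by
    simp only [norm_neg, norm_pow, norm_mul]
    exact (summable_geometric_of_lt_one (norm_nonneg _) hq).mul_left _)
  simpa [sub_eq_add_neg] using this

/-- Jacobi triple product -/
lemma JTP {q z : ℂ} (hq : ‖q‖ < 1) (h0 : q ≠ 0) (hz : z ≠ 0)
    (hs : Summable fun r : ℤ => ‖wt q r * z ^ r‖) :
    ∑' r : ℤ, wt q r * z ^ r =
      (∏' j : ℕ, (1 - z * q ^ j)) * (∏' j : ℕ, (1 - q / z * q ^ j)) * qInf q := by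
  have l1 := X_limit hq _ hs
  have l2 : Filter.Tendsto (fun n : ℕ => qP q (2 * n)) Filter.atTop (nhds (qInf q)) :=
    (qP_tendsto hq).comp (Filter.tendsto_id.const_mul_atTop' (by norm_num))
  have l3 := l2.mul l1
  have l4 := ((mult_geo hq z).tendsto_prod_tprod_nat).mul (mult_geo hq (q / z)).tendsto_prod_tprod_nat
  have e : ∀ n : ℕ, qP q (2 * n) * ∑' r : ℤ, wt q r * z ^ r * (iq q (n - r) * iq q (n + r)) =
      (∏ j ∈ Finset.range n, (1 - z * q ^ j)) * ∏ j ∈ Finset.range n, (1 - q / z * q ^ j) := by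
    intro n
    have := AGA_prod hq h0 hz n
    unfold AGA at this
    rw [this]
    congr 1
    refine Finset.prod_congr rfl fun j _ => ?_
    rw [pow_succ]; ring
  have := tendsto_nhds_unique (l3.congr e) l4
  rw [← this]
  have := qInf_ne hq
  field_simp

lemma exp_tri (ν s : ℕ) (r : ℤ) (d : ℕ) (hd : ν = s + d) :
    (2 * (ν : ℤ) + 3) * (r * (r - 1) / 2) + (s + 2 * d + 2 : ℕ) * r =
      ((s : ℤ) + d + 1) * r ^ 2 + (d + 1) * r + r * (r - 1) / 2 := by
  have := tri r
  subst hd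
  push_cast
  linear_combination ((s : ℤ) + d + 1) * this

lemma exp_lower (s d : ℕ) (r : ℤ) :
    (r.natAbs : ℤ) ≤ ((s : ℤ) + d + 1) * r ^ 2 + (d + 1) * r + r * (r - 1) / 2 := by
  have := tri r
  have h : 2 * (r.natAbs : ℤ) ≤ (2 * (s : ℤ) + 2 * d + 3) * r ^ 2 + (2 * d + 1) * r := by
    rcases Int.natAbs_eq r with h | h
    · set a := r.natAbs
      rw [h]
      nlinarith [sq_nonneg ((a : ℤ) - 1), mul_nonneg (Int.natCast_nonneg s) (sq_nonneg (a : ℤ)),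
        mul_nonneg (Int.natCast_nonneg d) (sq_nonneg (a : ℤ)),
        mul_nonneg (Int.natCast_nonneg d) (Int.natCast_nonneg a), Int.natCast_nonneg a]
    · set a := r.natAbs
      rw [h]
      have h2 : (a : ℤ) ≤ (a : ℤ) ^ 2 := by exact_mod_cast Nat.le_self_pow (by norm_num) a
      nlinarith [mul_nonneg (Int.natCast_nonneg s) (sq_nonneg (a : ℤ)),
        mul_nonneg (Int.natCast_nonneg d) (sub_nonneg.mpr h2), Int.natCast_nonneg a]
  nlinarith

lemma coef_eq {q : ℂ} (h0 : q ≠ 0) (s d : ℕ) (r : ℤ) :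
    wt (q ^ (2 * (s + d) + 3)) r * (q ^ (s + 2 * d + 2)) ^ r =
      q ^ (((s : ℤ) + d + 1) * r ^ 2 + (d + 1) * r) * wt q r := by
  unfold wt
  rw [mul_assoc, ← zpow_natCast, ← zpow_natCast, ← zpow_mul, ← zpow_mul, ← zpow_add₀ h0,
    mul_left_comm, ← zpow_add₀ h0, ← exp_tri (s + d) s r d rfl]
  push_cast; rfl

lemma coef_bound {q : ℂ} (hq : ‖q‖ < 1) (h0 : q ≠ 0) (s d : ℕ) :
    Summable fun r : ℤ => ‖q ^ (((s : ℤ) + d + 1) * r ^ 2 + (d + 1) * r) * wt q r‖ := by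
  have hs : Summable fun r : ℤ => ‖q‖ ^ r.natAbs := by
    have := summable_geometric_of_lt_one (norm_nonneg q) hq
    apply Summable.of_nat_of_neg <;> simpa using this
  refine Summable.of_nonneg_of_le (fun _ => norm_nonneg _) (fun r => ?_) hs
  unfold wt
  rw [mul_left_comm, ← zpow_add₀ h0, norm_mul, norm_zpow, norm_zpow, norm_neg, norm_one, one_zpow,
    one_mul, ← zpow_natCast]
  exact zpow_le_zpow_right_of_le_one₀ (norm_pos_iff.mpr h0) hq.le (exp_lower s d r)

lemma mod_char (k ρ : ℕ) (hρ : ρ < k) (j : ℕ) :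
    j ∈ Set.range (fun i : ℕ => k * i + ρ) ↔ j % k = ρ := by
  constructor
  · rintro ⟨i, rfl⟩
    simp [Nat.mod_eq_of_lt hρ]
  · intro h
    exact ⟨j / k, by simp only; rw [← h]; exact Nat.div_add_mod j k⟩

lemma mod_char0 (k : ℕ) (hk : 0 < k) (j : ℕ) :
    j ∈ Set.range (fun i : ℕ => k * i + k) ↔ 1 ≤ j ∧ j % k = 0 := by
  constructor
  · rintro ⟨i, rfl⟩
    refine ⟨by simp only; omega, by simp⟩
  · rintro ⟨h1, h⟩
    obtain ⟨c, rfl⟩ := Nat.dvd_of_mod_eq_zero h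
    cases c with
    | zero => omega
    | succ c => exact ⟨c, by simp only; ring⟩

lemma good_char (s d j : ℕ) :
    (1 ≤ j ∧ (j : ZMod (2 * (s + d) + 3)) ≠ 0 ∧
        (j : ZMod (2 * (s + d) + 3)) ≠ ((s + 1 : ℕ) : ZMod (2 * (s + d) + 3)) ∧
        (j : ZMod (2 * (s + d) + 3)) ≠ -((s + 1 : ℕ) : ZMod (2 * (s + d) + 3))) ↔
    (1 ≤ j ∧ j % (2 * (s + d) + 3) ≠ 0 ∧ j % (2 * (s + d) + 3) ≠ s + 1 ∧
      j % (2 * (s + d) + 3) ≠ s + 2 * d + 2) := by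
  have h1 : -((s + 1 : ℕ) : ZMod (2 * (s + d) + 3)) = ((s + 2 * d + 2 : ℕ) : ZMod (2 * (s + d) + 3)) := by
    rw [neg_eq_iff_add_eq_zero, ← Nat.cast_add,
      show s + 1 + (s + 2 * d + 2) = 2 * (s + d) + 3 by ring, ZMod.natCast_self]
  have h2 : (0 : ZMod (2 * (s + d) + 3)) = ((0 : ℕ) : ZMod (2 * (s + d) + 3)) := by simp
  rw [h1, h2]
  simp only [ne_eq, ZMod.natCast_eq_natCast_iff']
  rw [Nat.mod_eq_of_lt (show s + 1 < 2 * (s + d) + 3 by omega),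
    Nat.mod_eq_of_lt (show s + 2 * d + 2 < 2 * (s + d) + 3 by omega), Nat.zero_mod]

lemma hasProd_arith {q : ℂ} (hq : ‖q‖ < 1) (k ρ : ℕ) (hk : 0 < k) :
    HasProd ((fun j : ℕ => 1 - q ^ j) ∘ ((↑) : Set.range (fun i : ℕ => k * i + ρ) → ℕ))
      (∏' j : ℕ, (1 - q ^ ρ * (q ^ k) ^ j)) := by
  have hinj : Function.Injective (fun i : ℕ => k * i + ρ) := by
    intro a b h
    simp only [add_left_inj] at h
    exact Nat.eq_of_mul_eq_mul_left hk h
  refine (hinj.hasProd_range_iff (f := fun j : ℕ => 1 - q ^ j)).mpr ?_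
  have hQ : ‖q ^ k‖ < 1 := by
    rw [norm_pow]; exact pow_lt_one₀ (norm_nonneg _) hq hk.ne'
  convert (mult_geo hQ (q ^ ρ)).hasProd using 2 with j
  simp only [Function.comp]
  rw [pow_add, pow_mul]; ring

lemma prod_split {q : ℂ} (hq : ‖q‖ < 1) (s d : ℕ) :
    ∏' j : {j : ℕ // 1 ≤ j ∧ (j : ZMod (2 * (s + d) + 3)) ≠ 0 ∧
        (j : ZMod (2 * (s + d) + 3)) ≠ ((s + 1 : ℕ) : ZMod (2 * (s + d) + 3)) ∧
        (j : ZMod (2 * (s + d) + 3)) ≠ -((s + 1 : ℕ) : ZMod (2 * (s + d) + 3))},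
      (1 - q ^ (j : ℕ))⁻¹ =
    ((∏' j : ℕ, (1 - q ^ (s + 2 * d + 2) * (q ^ (2 * (s + d) + 3)) ^ j)) *
      (∏' j : ℕ, (1 - q ^ (s + 1) * (q ^ (2 * (s + d) + 3)) ^ j)) *
        qInf (q ^ (2 * (s + d) + 3))) / qInf q := by
  set k := 2 * (s + d) + 3 with hk
  have hk0 : 0 < k := by omega
  let f : ℕ → ℂ := fun j => 1 - q ^ j
  let S : Set ℕ := {j : ℕ | 1 ≤ j ∧ (j : ZMod k) ≠ 0 ∧
        (j : ZMod k) ≠ ((s + 1 : ℕ) : ZMod k) ∧ (j : ZMod k) ≠ -((s + 1 : ℕ) : ZMod k)}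
  have hS : ∀ j, j ∈ S ↔ (1 ≤ j ∧ j % k ≠ 0 ∧ j % k ≠ s + 1 ∧ j % k ≠ s + 2 * d + 2) :=
    fun j => good_char s d j
  have c1 := mod_char0 k hk0
  have c2 := mod_char k (s + 2 * d + 2) (by omega)
  have c3 := mod_char k (s + 1) (by omega)
  have p1 := hasProd_arith hq k k hk0
  have p2 := hasProd_arith hq k (s + 2 * d + 2) hk0
  have p3 := hasProd_arith hq k (s + 1) hk0
  have pS : Multipliable (f ∘ ((↑) : S → ℕ)) := by
    have := multipliable_one_add_of_summable (f := fun j : S => -q ^ (j : ℕ)) (by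
      simp only [norm_neg, norm_pow]
      exact (summable_geometric_of_lt_one (norm_nonneg _) hq).subtype S)
    simpa [f, Function.comp_def, sub_eq_add_neg] using this
  have hs := pS.hasProd
  set P := ∏' j : S, (f ∘ ((↑) : S → ℕ)) j with hP
  have u1 := p2.mul_disjoint (Set.disjoint_left.mpr fun j h2 h3 => by
    rw [c2] at h2; rw [c3] at h3; omega) p3
  have u2 := u1.mul_disjoint (Set.disjoint_left.mpr fun j h2 h3 => by
    rw [Set.mem_union, c2, c3] at h2; rw [c1] at h3; omega) p1
  have u3 := HasProd.mul_disjoint (f := f) (Set.disjoint_left.mpr fun j h2 h3 => by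
    rw [hS] at h2; rw [Set.mem_union, Set.mem_union, c1, c2, c3] at h3; omega) hs u2
  have hall : S ∪ (Set.range (fun i : ℕ => k * i + (s + 2 * d + 2)) ∪
      Set.range (fun i : ℕ => k * i + (s + 1)) ∪ Set.range (fun i : ℕ => k * i + k)) =
      Set.range (fun i : ℕ => 1 * i + 1) := by
    ext j
    rw [Set.mem_union, Set.mem_union, Set.mem_union, hS, c1, c2, c3, mod_char0 1 one_pos]
    have : j % 1 = 0 := Nat.mod_one j
    have h0 : j = 0 → j % k = 0 := by rintro rfl; simp
    omega
  rw [hall] at u3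
  have u4 := hasProd_arith hq 1 1 one_pos
  have key := u3.unique u4
  have e1 : (∏' j : ℕ, (1 - q ^ 1 * (q ^ 1) ^ j)) = qInf q := by
    unfold qInf
    refine tprod_congr fun j => ?_
    rw [pow_one, pow_succ]; ring
  have e2 : (∏' j : ℕ, (1 - q ^ k * (q ^ k) ^ j)) = qInf (q ^ k) := by
    unfold qInf
    refine tprod_congr fun j => ?_
    rw [pow_succ (q ^ k)]; ring
  rw [e1, e2] at key
  have hq0 := qInf_ne hq
  have hP0 : P ≠ 0 := by
    intro h
    rw [h, zero_mul] at key
    exact hq0 key.symm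
  have hinv : HasProd (fun j : S => (1 - q ^ (j : ℕ))⁻¹) P⁻¹ := by
    have := Filter.Tendsto.inv₀ hs hP0
    refine this.congr fun F => ?_
    rw [← Finset.prod_inv_distrib]; rfl
  refine hinv.tprod_eq.trans ?_
  rw [eq_div_iff hq0, ← key, inv_mul_cancel_left₀ hP0]

lemma AG_main {q : ℂ} (hq : ‖q‖ < 1) (h0 : q ≠ 0) (s d : ℕ) :
    ∑' t : Fin (s + d) → ℕ, q ^ expAG (s + d) s t * (∏ i, qP q (t i))⁻¹ =
    ((∏' j : ℕ, (1 - q ^ (s + 2 * d + 2) * (q ^ (2 * (s + d) + 3)) ^ j)) *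
      (∏' j : ℕ, (1 - q ^ (s + 1) * (q ^ (2 * (s + d) + 3)) ^ j)) *
        qInf (q ^ (2 * (s + d) + 3))) / qInf q := by
  have hQ : ‖q ^ (2 * (s + d) + 3)‖ < 1 := by
    rw [norm_pow]; exact pow_lt_one₀ (norm_nonneg _) hq (by omega)
  have hb := coef_bound hq h0 s d
  have l1 := G_limit hq (s + d) s
  have l2 := X_limit hq _ hb
  have l3 := tendsto_nhds_unique (l1.congr fun N => by
    rw [AGG_s hq h0 d s N, AGX]
    simp only [Nat.cast_zero, add_zero]) l2
  have hJ := JTP (z := q ^ (s + 2 * d + 2)) hQ (pow_ne_zero _ h0) (pow_ne_zero _ h0) (by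
    simpa only [coef_eq h0] using hb)
  simp only [coef_eq h0] at hJ
  have hz : q ^ (2 * (s + d) + 3) / q ^ (s + 2 * d + 2) = q ^ (s + 1) := by
    rw [div_eq_iff (pow_ne_zero _ h0), ← pow_add]; congr 1; ring
  rw [hz] at hJ
  rw [← hJ]
  have := qInf_ne hq
  rw [← mul_assoc] at l3
  have l4 := mul_right_cancel₀ (inv_ne_zero this) l3
  rw [l4, div_eq_mul_inv]

lemma exp_zero_iff {ν s : ℕ} (t : Fin ν → ℕ) (h : expAG ν s t = 0) : t = 0 := by
  have := exp_ge s t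
  rw [h, Nat.le_zero, Finset.sum_eq_zero_iff] at this
  ext i
  exact this i (Finset.mem_univ _)

theorem stmt_1 (ν : ℕ) (hν : 1 ≤ ν) (s : ℕ) (hs : s ≤ ν) (q : ℂ) (hq : ‖q‖ < 1) :
    ∑' nn : Fin ν → ℕ, q ^ expAG ν s nn / ∏ i : Fin ν, qP q (nn i) =
    ∏' j : {j : ℕ // 1 ≤ j ∧ (j : ZMod (2 * ν + 3)) ≠ 0 ∧
        (j : ZMod (2 * ν + 3)) ≠ ((s + 1 : ℕ) : ZMod (2 * ν + 3)) ∧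
        (j : ZMod (2 * ν + 3)) ≠ -((s + 1 : ℕ) : ZMod (2 * ν + 3))},
      (1 - q ^ (j : ℕ))⁻¹ := by
  by_cases h0 : q = 0
  · subst h0
    have hR : ∀ j : {j : ℕ // 1 ≤ j ∧ (j : ZMod (2 * ν + 3)) ≠ 0 ∧
        (j : ZMod (2 * ν + 3)) ≠ ((s + 1 : ℕ) : ZMod (2 * ν + 3)) ∧
        (j : ZMod (2 * ν + 3)) ≠ -((s + 1 : ℕ) : ZMod (2 * ν + 3))},
        (1 - (0 : ℂ) ^ (j : ℕ))⁻¹ = 1 := by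
      intro j
      have := j.2.1
      rw [zero_pow (by omega)]; simp
    rw [tprod_congr hR, tprod_one, tsum_eq_single 0]
    · simp [expAG, NN, qP]
    · intro t ht
      rw [zero_pow fun h => ht (exp_zero_iff t h), zero_div]
  · obtain ⟨d, rfl⟩ := Nat.exists_eq_add_of_le hs
    simp only [div_eq_mul_inv (_ ^ _)]
    rw [AG_main hq h0 s d, ← prod_split hq s d]

end
end
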